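/- arXiv:1206.3141 — 9 statements merged into one kernel-verified Lean document; each statement's English description precedes it below -/
import Mathlib

section
/- Let f : I → ℝ be differentiable on the interior I° of an interval I ⊆ ℝ, let a, b ∈ I with a < b, let φ : [a,b] → [a,b] be a map with φ(a) ≠ φ(b), let c ∈ ℝ, and suppose f′ is Lebesgue integrable on [a,b]. Then (1/(φ(b) − φ(a))) ∫_{φ(a)}^{φ(b)} f(x) dx − f((φ(a) + φ(b))/2) = (φ(b) − φ(a)) { ∫_0^{1/2} t [ f′(t φ(a) + (1 − t) φ(b)) + c t (1 − t)(φ(b) − φ(a))² ] dt + ∫_{1/2}^1 (t − 1) [ f′(t φ(a) + (1 − t) φ(b)) + c t (1 − t)(φ(b) − φ(a))² ] dt }. -/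
open MeasureTheory Set intervalIntegral

theorem stmt9_core (H k : ℝ → ℝ) (hH : ContinuousOn H (Icc 0 1))
    (hk : ∀ t ∈ Ioo (0:ℝ) 1, HasDerivAt H (k t) t) (hi : IntervalIntegrable k volume 0 1) (e : ℝ) :
    (∫ t in (0:ℝ)..(1/2), t * (k t + e * (t * (1 - t)))) +
      (∫ t in (1/2:ℝ)..1, (t - 1) * (k t + e * (t * (1 - t)))) =
    H (1/2) - ∫ t in (0:ℝ)..1, H t := by
  have hHi : IntervalIntegrable H volume 0 1 := by
    apply ContinuousOn.intervalIntegrable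
    rwa [uIcc_of_le zero_le_one]
  have s1 : uIcc (0:ℝ) (1/2) ⊆ uIcc 0 1 := by
    rw [uIcc_of_le (by norm_num), uIcc_of_le (by norm_num)]
    exact Icc_subset_Icc le_rfl (by norm_num)
  have s2 : uIcc (1/2:ℝ) 1 ⊆ uIcc 0 1 := by
    rw [uIcc_of_le (by norm_num), uIcc_of_le (by norm_num)]
    exact Icc_subset_Icc (by norm_num) le_rfl
  have hH' : ContinuousOn H (uIcc 0 1) := by rwa [uIcc_of_le zero_le_one]
  have k1 := hi.mono_set s1
  have k2 := hi.mono_set s2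
  have e1 := integral_mul_deriv_eq_deriv_mul_of_hasDerivAt (a := 0) (b := 1/2)
    (u := fun t : ℝ => t) (u' := fun _ => 1) (v := H) (v' := k) (by fun_prop) (hH'.mono s1)
    (fun x _ => hasDerivAt_id x)
    (fun x hx => hk x (by
      rw [min_eq_left (by norm_num), max_eq_right (by norm_num)] at hx
      exact ⟨hx.1, by linarith [hx.2]⟩)) (by simp) k1
  have e2 := integral_mul_deriv_eq_deriv_mul_of_hasDerivAt (a := 1/2) (b := 1)
    (u := fun t : ℝ => t - 1) (u' := fun _ => 1) (v := H) (v' := k) (by fun_prop) (hH'.mono s2)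
    (fun x _ => (hasDerivAt_id x).sub_const 1)
    (fun x hx => hk x (by
      rw [min_eq_left (by norm_num), max_eq_right (by norm_num)] at hx
      exact ⟨by linarith [hx.1], hx.2⟩)) (by simp) k2
  have p1 : ∫ t in (0:ℝ)..(1/2), t * (e * (t * (1 - t))) = e * (5/192) := by
    rw [integral_eq_sub_of_hasDerivAt (f := fun t => e * (t^3/3 - t^4/4))]
    · ring
    · intro x _
      have := (((hasDerivAt_pow 3 x).div_const 3).sub ((hasDerivAt_pow 4 x).div_const 4)).const_mul e
      refine HasDerivAt.congr_deriv this ?_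
      push_cast
      ring
    · exact Continuous.intervalIntegrable (by fun_prop) _ _
  have p2 : ∫ t in (1/2:ℝ)..1, (t - 1) * (e * (t * (1 - t))) = - (e * (5/192)) := by
    rw [integral_eq_sub_of_hasDerivAt (f := fun t => e * (2 * (t^3/3) - t^4/4 - t^2/2))]
    · ring
    · intro x _
      have := (((((hasDerivAt_pow 3 x).div_const 3).const_mul 2).sub
        ((hasDerivAt_pow 4 x).div_const 4)).sub ((hasDerivAt_pow 2 x).div_const 2)).const_mul e
      refine HasDerivAt.congr_deriv this ?_
      push_cast
      ring
    · exact Continuous.intervalIntegrable (by fun_prop) _ _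
  have q := integral_add_adjacent_intervals (hHi.mono_set s1) (hHi.mono_set s2)
  simp only [mul_add]
  rw [integral_add (k1.continuousOn_mul (by fun_prop))
      (Continuous.intervalIntegrable (by fun_prop) _ _),
    integral_add (k2.continuousOn_mul (by fun_prop))
      (Continuous.intervalIntegrable (by fun_prop) _ _), p1, p2, e1, e2, ← q]
  simp only [one_mul]
  ring

theorem stmt9 (I : Set ℝ) (hI : Convex ℝ I) (a b : ℝ) (ha : a ∈ I) (hb : b ∈ I)
    (hab : a < b) (f f' φ : ℝ → ℝ)
    (hf : ∀ x ∈ interior I, HasDerivAt f (f' x) x)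
    (hφmap : ∀ x ∈ Set.Icc a b, φ x ∈ Set.Icc a b)
    (hφab : φ a ≠ φ b) (c : ℝ)
    (hf'int : MeasureTheory.IntegrableOn f' (Set.Icc a b)) :
    (1 / (φ b - φ a)) * (∫ x in φ a..φ b, f x) - f ((φ a + φ b) / 2) =
      (φ b - φ a) *
        ((∫ t in (0:ℝ)..(1/2),
            t * (f' (t * φ a + (1 - t) * φ b) + c * t * (1 - t) * (φ b - φ a) ^ 2)) +
          ∫ t in (1/2:ℝ)..1,
            (t - 1) * (f' (t * φ a + (1 - t) * φ b) + c * t * (1 - t) * (φ b - φ a) ^ 2)) := by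
  have hoo : Ioo a b ⊆ interior I := by
    rw [← interior_Icc]
    exact interior_mono (hI.ordConnected.out ha hb)
  have hp := hφmap a (left_mem_Icc.2 hab.le)
  have hq := hφmap b (right_mem_Icc.2 hab.le)
  generalize φ a = p at *
  generalize φ b = q at *
  have hd : q - p ≠ 0 := sub_ne_zero.2 (Ne.symm hφab)
  have hint : IntervalIntegrable f' volume a b :=
    (intervalIntegrable_iff_integrableOn_Icc_of_le hab.le).2 hf'int
  have hin : ∀ t ∈ Ioo (0:ℝ) 1, q - (q - p) * t ∈ Ioo a b := by
    intro t ht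
    obtain ⟨h0, h1⟩ := ht
    rcases lt_or_gt_of_ne hφab with h | h
    · constructor
      · nlinarith [hp.1, hq.2]
      · nlinarith [hp.1, hq.2]
    · constructor
      · nlinarith [hp.2, hq.1]
      · nlinarith [hp.2, hq.1]
  have hin' : ∀ t ∈ Icc (0:ℝ) 1, q - (q - p) * t ∈ Icc a b := by
    intro t ht
    obtain ⟨h0, h1⟩ := ht
    constructor
    · nlinarith [hp.1, hq.1]
    · nlinarith [hp.2, hq.2]
  have hm : (p + q) / 2 ∈ Ioo a b := by
    have := hin (1/2) (by norm_num)
    convert this using 1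
    ring
  set m := (p + q) / 2 with hmdef
  let F : ℝ → ℝ := fun x => f m + ∫ y in m..x, f' y
  have hFf : ∀ x ∈ Ioo a b, F x = f x := by
    intro x hx
    have hs : uIcc m x ⊆ Ioo a b := ordConnected_Ioo.uIcc_subset hm hx
    have : ∫ y in m..x, f' y = f x - f m :=
      integral_eq_sub_of_hasDerivAt (fun y hy => hf y (hoo (hs hy)))
        (hint.mono_set (hs.trans (by rw [uIcc_of_le hab.le]; exact Ioo_subset_Icc_self)))
    simp only [F, this]
    ring
  have hFc : ContinuousOn F (Icc a b) := by
    have h := continuousOn_primitive_interval' hint (a := m)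
      (by rw [uIcc_of_le hab.le]; exact Ioo_subset_Icc_self hm)
    rw [uIcc_of_le hab.le] at h
    exact continuousOn_const.add h
  have hFd : ∀ x ∈ Ioo a b, HasDerivAt F (f' x) x := by
    intro x hx
    refine (hf x (hoo hx)).congr_of_eventuallyEq ?_
    filter_upwards [isOpen_Ioo.mem_nhds hx] with y hy using hFf y hy
  have hkint : IntervalIntegrable (fun t => f' (q - (q - p) * t)) volume 0 1 := by
    have h1 : IntervalIntegrable f' volume q p := by
      apply hint.mono_set
      rw [uIcc_of_le hab.le]
      exact ordConnected_Icc.uIcc_subset hq hp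
    have h2 := (h1.comp_sub_left q).comp_mul_left (c := q - p)
    simpa [hd] using h2
  have key := stmt9_core (fun t => F (q - (q - p) * t)) (fun t => -(q - p) * f' (q - (q - p) * t))
    (hFc.comp (by fun_prop) hin')
    (fun t ht => by
      have h1 : HasDerivAt (fun t : ℝ => q - (q - p) * t) (-(q - p)) t := by
        simpa using ((hasDerivAt_id t).const_mul (q - p)).const_sub q
      have := (hFd _ (hin t ht)).comp t h1
      rw [mul_comm]
      exact this)
    (hkint.const_mul _) (-(q - p) * (c * (q - p) ^ 2))
  have hmid : q - (q - p) * (1 / 2) = m := by rw [hmdef]; ring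
  have hcv : ∫ t in (0:ℝ)..1, F (q - (q - p) * t) = (q - p)⁻¹ * ∫ x in p..q, f x := by
    rw [integral_comp_sub_mul F hd q]
    have : ∫ x in p..q, f x = ∫ x in p..q, F x := by
      apply integral_congr_uIoo
      intro x hx
      refine (hFf x ⟨lt_of_le_of_lt (le_min hp.1 hq.1) hx.1,
        lt_of_lt_of_le hx.2 (max_le hp.2 hq.2)⟩).symm
    rw [this]
    simp
  simp only [hmid] at key
  rw [hcv, hFf m hm] at key
  have r1 : ∀ u v : ℝ, ∀ g : ℝ → ℝ,
      ∫ t in u..v, g t * (-(q - p) * f' (q - (q - p) * t)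
        + -(q - p) * (c * (q - p) ^ 2) * (t * (1 - t))) =
      -((q - p) * ∫ t in u..v, g t * (f' (t * p + (1 - t) * q) + c * t * (1 - t) * (q - p) ^ 2)) := by
    intro u v g
    rw [← neg_mul, ← intervalIntegral.integral_const_mul]
    apply integral_congr
    intro t _
    have : t * p + (1 - t) * q = q - (q - p) * t := by ring
    simp only [this]
    ring
  rw [r1 0 (1/2) (fun t => t), r1 (1/2) 1 (fun t => t - 1)] at key
  rw [one_div (q - p)]
  linarith
end

section
/- Let h : (0,1) → (0,∞) be Lebesgue integrable, let f : I → ℝ be differentiable on the interior I° of an interval I ⊆ ℝ with a, b ∈ I, a < b, and f′ Lebesgue integrable, and let φ : [a,b] → [a,b] be continuous with φ(a) < φ(b). If |f′| is strongly φ_h-convex with modulus c > 0, then |(1/(φ(b) − φ(a))) ∫_{φ(a)}^{φ(b)} f(x) dx − f((φ(a) + φ(b))/2)| ≤ (φ(b) − φ(a)) (|f′(φ(a))| + |f′(φ(b))|) ∫_0^{1/2} t [h(t) + h(1 − t)] dt. -/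
open MeasureTheory Set intervalIntegral

/-- `g` is strongly `φ_h`-convex with modulus `c` on `[a,b]`. -/
def StronglyPhiHConvexOn (a b : ℝ) (φ : ℝ → ℝ) (h : ℝ → ℝ) (c : ℝ) (g : ℝ → ℝ) : Prop :=
  ∀ x ∈ Set.Icc a b, ∀ y ∈ Set.Icc a b, ∀ t ∈ Set.Ioo (0:ℝ) 1,
    g (t * φ x + (1 - t) * φ y) ≤
      h t * g (φ x) + h (1 - t) * g (φ y) - c * t * (1 - t) * (φ x - φ y) ^ 2
lemma aux_int (h : ℝ → ℝ) (hhint : MeasureTheory.IntegrableOn h (Set.Ioo 0 1)) :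
    IntervalIntegrable (fun t => t * h t) volume 0 (1/2) ∧
    IntervalIntegrable (fun t => t * h (1 - t)) volume 0 (1/2) := by
  have h1 : IntervalIntegrable h volume 0 1 := by
    rw [intervalIntegrable_iff_integrableOn_Ioo_of_le zero_le_one]; exact hhint
  have h2 : IntervalIntegrable (fun t => h (1 - t)) volume 0 1 := by
    have := (h1.comp_sub_left 1).symm
    simpa using this
  have hs : Set.uIcc (0:ℝ) (1/2) ⊆ Set.uIcc 0 1 := by
    rw [Set.uIcc_of_le (by norm_num), Set.uIcc_of_le (by norm_num)]
    exact Set.Icc_subset_Icc le_rfl (by norm_num)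
  exact ⟨(h1.mono_set hs).continuousOn_mul continuousOn_id,
    (h2.mono_set hs).continuousOn_mul continuousOn_id⟩

lemma aux_bound (h f' : ℝ → ℝ) (hhint : MeasureTheory.IntegrableOn h (Set.Ioo 0 1))
    (s d A B : ℝ) (hd : d ≠ 0)
    (hK : ∀ t ∈ Set.Ioo (0:ℝ) 1, |f' (d * t + s)| ≤ h t * A + h (1 - t) * B) :
    |∫ x in s..(s + d/2), (x - s) * f' x| ≤
      d^2 * ((∫ t in (0:ℝ)..(1/2), t * h t) * A + (∫ t in (0:ℝ)..(1/2), t * h (1 - t)) * B) := by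
  obtain ⟨i1, i2⟩ := aux_int h hhint
  have e := intervalIntegral.integral_comp_mul_add (a := 0) (b := 1/2)
    (fun x => (x - s) * f' x) hd s
  have e2 : ∫ x in s..(s + d/2), (x - s) * f' x =
      d^2 * ∫ t in (0:ℝ)..(1/2), t * f' (d * t + s) := by
    have e3 : (∫ t in (0:ℝ)..(1/2), (d * t + s - s) * f' (d * t + s)) =
        d * ∫ t in (0:ℝ)..(1/2), t * f' (d * t + s) := by
      rw [← intervalIntegral.integral_const_mul]
      congr 1; ext t; ring
    have e4 : d * 0 + s = s := by ring
    have e5 : d * (1/2) + s = s + d/2 := by ring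
    simp only [e3, e4, e5, smul_eq_mul] at e
    have e6 := (eq_inv_mul_iff_mul_eq₀ hd).1 e
    rw [← e6]; ring
  rw [e2, abs_mul, abs_of_nonneg (sq_nonneg d)]
  refine mul_le_mul_of_nonneg_left ?_ (sq_nonneg d)
  rw [← intervalIntegral.integral_mul_const, ← intervalIntegral.integral_mul_const,
    ← intervalIntegral.integral_add (i1.mul_const A) (i2.mul_const B)]
  rw [← Real.norm_eq_abs]
  refine intervalIntegral.norm_integral_le_of_norm_le (by norm_num) ?_
    ((i1.mul_const A).add (i2.mul_const B))
  refine Filter.Eventually.of_forall fun t ht => ?_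
  have := hK t ⟨ht.1, by linarith [ht.2]⟩
  rw [Real.norm_eq_abs, abs_mul, abs_of_pos ht.1]
  nlinarith [mul_le_mul_of_nonneg_left this ht.1.le]

lemma aux_parts (F f' : ℝ → ℝ) (s m : ℝ) (hF : ContinuousOn F (Set.uIcc s m))
    (hd : ∀ x ∈ Set.Ioo (min s m) (max s m), HasDerivAt F (f' x) x)
    (hi : IntervalIntegrable f' volume s m) :
    ∫ x in s..m, (x - s) * f' x = (m - s) * F m - ∫ x in s..m, F x := by
  have := intervalIntegral.integral_mul_deriv_eq_deriv_mul_of_hasDeriv_right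
    (u := fun x => x - s) (u' := fun _ => 1) (v := F) (v' := f') (a := s) (b := m)
    (by fun_prop) hF (fun x _ => ((hasDerivAt_id x).sub_const s).hasDerivWithinAt)
    (fun x hx => (hd x hx).hasDerivWithinAt) (by simp) hi
  simpa using this

theorem stmt10 (h : ℝ → ℝ) (hhpos : ∀ t ∈ Set.Ioo (0:ℝ) 1, 0 < h t)
    (hhint : MeasureTheory.IntegrableOn h (Set.Ioo 0 1))
    (I : Set ℝ) (hI : Convex ℝ I) (a b : ℝ) (ha : a ∈ I) (hb : b ∈ I)
    (hab : a < b) (f f' φ : ℝ → ℝ)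
    (hf : ∀ x ∈ interior I, HasDerivAt f (f' x) x)
    (hf'int : MeasureTheory.IntegrableOn f' (Set.Icc a b))
    (hφmap : ∀ x ∈ Set.Icc a b, φ x ∈ Set.Icc a b)
    (hφcont : ContinuousOn φ (Set.Icc a b))
    (hφab : φ a < φ b)
    (c : ℝ) (hc : 0 < c)
    (hconv : StronglyPhiHConvexOn a b φ h c (fun x => |f' x|)) :
    |(1 / (φ b - φ a)) * (∫ x in φ a..φ b, f x) - f ((φ a + φ b) / 2)| ≤
      (φ b - φ a) * (|f' (φ a)| + |f' (φ b)|) *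
        ∫ t in (0:ℝ)..(1/2), t * (h t + h (1 - t)) := by
  have hpI := hφmap a ⟨le_rfl, hab.le⟩
  have hqI := hφmap b ⟨hab.le, le_rfl⟩
  have k1 : ∀ t ∈ Set.Ioo (0:ℝ) 1, |f' ((φ b - φ a) * t + φ a)| ≤
      h t * |f' (φ b)| + h (1 - t) * |f' (φ a)| := by
    intro t ht
    have := hconv b ⟨hab.le, le_rfl⟩ a ⟨le_rfl, hab.le⟩ t ht
    have e : t * φ b + (1 - t) * φ a = (φ b - φ a) * t + φ a := by ring
    simp only [e] at this
    have : 0 ≤ c * t * (1 - t) * (φ b - φ a) ^ 2 := by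
      have := ht.1; have : 0 < 1 - t := by linarith [ht.2]
      positivity
    linarith
  have k2 : ∀ t ∈ Set.Ioo (0:ℝ) 1, |f' ((φ a - φ b) * t + φ b)| ≤
      h t * |f' (φ a)| + h (1 - t) * |f' (φ b)| := by
    intro t ht
    have := hconv a ⟨le_rfl, hab.le⟩ b ⟨hab.le, le_rfl⟩ t ht
    have e : t * φ a + (1 - t) * φ b = (φ a - φ b) * t + φ b := by ring
    simp only [e] at this
    have : 0 ≤ c * t * (1 - t) * (φ a - φ b) ^ 2 := by
      have := ht.1; have : 0 < 1 - t := by linarith [ht.2]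
      positivity
    linarith
  have b1 := aux_bound h f' hhint _ _ _ _ (sub_pos.2 hφab).ne' k1
  have b2 := aux_bound h f' hhint _ _ _ _ (sub_neg.2 hφab).ne k2
  obtain ⟨i1, i2⟩ := aux_int h hhint
  have eR : (∫ t in (0:ℝ)..(1/2), t * (h t + h (1 - t))) =
      (∫ t in (0:ℝ)..(1/2), t * h t) + ∫ t in (0:ℝ)..(1/2), t * h (1 - t) := by
    rw [← intervalIntegral.integral_add i1 i2]
    congr 1; ext t; ring
  rw [eR]
  clear hconv k1 k2 eR
  generalize (∫ t in (0:ℝ)..(1/2), t * h t) = J1 at *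
  generalize (∫ t in (0:ℝ)..(1/2), t * h (1 - t)) = J2 at *
  generalize φ a = p at *
  generalize φ b = q at *
  have em1 : p + (q - p) / 2 = (p + q) / 2 := by ring
  have em2 : q + (p - q) / 2 = (p + q) / 2 := by ring
  rw [em1] at b1
  rw [em2] at b2
  obtain ⟨m, hm⟩ : ∃ m, m = (p + q) / 2 := ⟨_, rfl⟩
  rw [← hm] at b1 b2 ⊢
  have hpm : p < m := by linarith
  have hmq : m < q := by linarith
  have hsub : Set.Icc p q ⊆ Set.Icc a b := Set.Icc_subset_Icc hpI.1 hqI.2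
  have hderiv : ∀ x ∈ Set.Ioo p q, HasDerivAt f (f' x) x := by
    intro x hx
    refine hf x (interior_mono (hI.ordConnected.out ha hb) ?_)
    rw [interior_Icc]
    exact ⟨lt_of_le_of_lt hpI.1 hx.1, lt_of_lt_of_le hx.2 hqI.2⟩
  have hint : IntegrableOn f' (Set.Icc p q) := hf'int.mono_set hsub
  have hii : ∀ x ∈ Set.Icc p q, ∀ y ∈ Set.Icc p q, IntervalIntegrable f' volume x y := by
    intro x hx y hy
    exact (hint.mono_set (Set.uIcc_subset_Icc hx hy)).intervalIntegrable
  have hmI : m ∈ Set.Icc p q := ⟨hpm.le, hmq.le⟩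
  have hpI' : p ∈ Set.Icc p q := ⟨le_rfl, hφab.le⟩
  have hqI' : q ∈ Set.Icc p q := ⟨hφab.le, le_rfl⟩
  let F : ℝ → ℝ := fun x => f m + ∫ y in m..x, f' y
  have hFf : ∀ x ∈ Set.Ioo p q, F x = f x := by
    intro x hx
    have := intervalIntegral.integral_eq_sub_of_hasDerivAt (a := m) (b := x) (f := f) (f' := f')
      (fun y hy => hderiv y (Set.ordConnected_Ioo.uIcc_subset ⟨hpm, hmq⟩ hx hy))
      (hii m hmI x ⟨hx.1.le, hx.2.le⟩)
    simp only [F, this]; ring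
  have hFc : ContinuousOn F (Set.Icc p q) := by
    refine continuousOn_const.add ?_
    have := intervalIntegral.continuousOn_primitive_interval' (hii p hpI' q hqI')
      (a := m) (by rw [Set.uIcc_of_le hφab.le]; exact hmI)
    rwa [Set.uIcc_of_le hφab.le] at this
  have hFd : ∀ x ∈ Set.Ioo p q, HasDerivAt F (f' x) x := by
    intro x hx
    refine (hderiv x hx).congr_of_eventuallyEq ?_
    filter_upwards [isOpen_Ioo.mem_nhds hx] with y hy using hFf y hy
  have hFm : F m = f m := by simp [F]
  have p1 := aux_parts F f' p m (hFc.mono (Set.uIcc_subset_Icc hpI' hmI))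
    (fun x hx => hFd x (by
      rw [min_eq_left hpm.le, max_eq_right hpm.le] at hx
      exact ⟨hx.1, hx.2.trans hmq⟩)) (hii p hpI' m hmI)
  have p2 := aux_parts F f' q m (hFc.mono (Set.uIcc_subset_Icc hqI' hmI))
    (fun x hx => hFd x (by
      rw [min_eq_right hmq.le, max_eq_left hmq.le] at hx
      exact ⟨hpm.trans hx.1, hx.2⟩)) (hii q hqI' m hmI)
  have hFi : (∫ x in p..q, f x) = ∫ x in p..q, F x := by
    rw [intervalIntegral.integral_of_le hφab.le, intervalIntegral.integral_of_le hφab.le,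
      integral_Ioc_eq_integral_Ioo, integral_Ioc_eq_integral_Ioo]
    exact setIntegral_congr_fun measurableSet_Ioo fun x hx => (hFf x hx).symm
  have hadd : (∫ x in p..m, F x) + (∫ x in m..q, F x) = ∫ x in p..q, F x :=
    intervalIntegral.integral_add_adjacent_intervals
      (hFc.mono (Set.uIcc_subset_Icc hpI' hmI)).intervalIntegrable
      (hFc.mono (Set.uIcc_subset_Icc hmI hqI')).intervalIntegrable
  rw [intervalIntegral.integral_symm m q (f := F)] at p2
  have hd : 0 < q - p := sub_pos.2 hφab
  have key : 1 / (q - p) * (∫ x in p..q, f x) - f m =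
      (1 / (q - p)) * ((∫ x in q..m, (x - q) * f' x) - ∫ x in p..m, (x - p) * f' x) := by
    rw [p1, p2, hFi, ← hadd, hFm]
    field_simp
    ring
  rw [key, abs_mul, abs_of_pos (by positivity), one_div, inv_mul_le_iff₀ hd]
  refine (abs_sub _ _).trans ?_
  nlinarith [b1, b2]
end

section
/- Let f : I → ℝ be differentiable on the interior I° of an interval I ⊆ ℝ with a, b ∈ I, a < b, and f′ Lebesgue integrable, and let φ : [a,b] → [a,b] be continuous with φ(a) < φ(b). If |f′| is strongly φ-convex with modulus c > 0 (i.e. strongly φ_h-convex with h(t) = t), then |(1/(φ(b) − φ(a))) ∫_{φ(a)}^{φ(b)} f(x) dx − f((φ(a) + φ(b))/2)| ≤ (φ(b) − φ(a)) (|f′(φ(a))| + |f′(φ(b))|)/8. -/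
open MeasureTheory Set intervalIntegral

lemma aux_mono (u v : ℝ) (F F' : ℝ → ℝ) (hF : ∀ x ∈ Ioo u v, HasDerivAt F (F' x) x)
    (h0 : ∀ x ∈ Ioo u v, 0 ≤ F' x) : MonotoneOn F (Ioo u v) := by
  apply monotoneOn_of_deriv_nonneg (convex_Ioo u v)
  · exact fun x hx => (hF x hx).continuousAt.continuousWithinAt
  · rw [interior_Ioo]
    exact fun x hx => (hF x hx).differentiableAt.differentiableWithinAt
  · rw [interior_Ioo]
    intro x hx
    rw [(hF x hx).deriv]
    exact h0 x hx

lemma aux_int_s11 (g d m p q : ℝ) :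
    ∫ x in p..q, (g * (x - m) + d * (x - m) ^ 2) =
      (g * (q - m) ^ 2 / 2 + d * (q - m) ^ 3 / 3) - (g * (p - m) ^ 2 / 2 + d * (p - m) ^ 3 / 3) := by
  apply integral_eq_sub_of_hasDerivAt (f := fun x => g * (x - m) ^ 2 / 2 + d * (x - m) ^ 3 / 3)
  · intro x _
    have h1 : HasDerivAt (fun x : ℝ => x - m) 1 x := (hasDerivAt_id x).sub_const m
    have := (((h1.pow 2).const_mul g).div_const 2).add (((h1.pow 3).const_mul d).div_const 3)
    refine HasDerivAt.congr_deriv this ?_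
    push_cast
    ring
  · exact Continuous.intervalIntegrable (by fun_prop) _ _

lemma aux_main (u v : ℝ) (huv : u < v) (f f' : ℝ → ℝ) (A B : ℝ)
    (hf : ∀ x ∈ Ioo u v, HasDerivAt f (f' x) x)
    (hb : ∀ x ∈ Ioo u v, |f' x| ≤ (A + B) / 2 + (B - A) / (v - u) * (x - (u + v) / 2)) :
    |(1 / (v - u)) * (∫ x in u..v, f x) - f ((u + v) / 2)| ≤ (v - u) * (A + B) / 8 := by
  have hL : 0 < v - u := by linarith
  obtain ⟨m, hm⟩ : ∃ m, m = (u + v) / 2 := ⟨_, rfl⟩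
  obtain ⟨g, hg⟩ : ∃ g, g = (A + B) / 2 := ⟨_, rfl⟩
  obtain ⟨d, hd⟩ : ∃ d, d = (B - A) / (v - u) / 2 := ⟨_, rfl⟩
  rw [← hm]
  have hum : u < m := by linarith
  have hmv : m < v := by linarith
  have hmI : m ∈ Ioo u v := ⟨hum, hmv⟩
  have hb' : ∀ x ∈ Ioo u v, |f' x| ≤ g + 2 * d * (x - m) := by
    intro x hx
    have := hb x hx
    rw [← hm, ← hg] at this
    rw [hd]
    linarith
  have hP : ∀ x, HasDerivAt (fun x => g * (x - m) + d * (x - m) ^ 2) (g + 2 * d * (x - m)) x := by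
    intro x
    have h1 : HasDerivAt (fun x : ℝ => x - m) 1 x := (hasDerivAt_id x).sub_const m
    have := (h1.const_mul g).add ((h1.pow 2).const_mul d)
    refine HasDerivAt.congr_deriv this ?_
    push_cast
    ring
  have m1 := aux_mono u v _ _ (fun x hx => (hP x).sub (hf x hx))
    (fun x hx => by have := abs_le.1 (hb' x hx); linarith [this.2])
  have m2 := aux_mono u v _ _ (fun x hx => (hP x).add (hf x hx))
    (fun x hx => by have := abs_le.1 (hb' x hx); linarith [this.1])
  have hr : ∀ x ∈ Ioo u v, m ≤ x → ‖f x - f m‖ ≤ g * (x - m) + d * (x - m) ^ 2 := by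
    intro x hx h
    have h1 := m1 hmI hx h
    have h2 := m2 hmI hx h
    simp at h1 h2
    rw [Real.norm_eq_abs, abs_le]
    constructor <;> linarith
  have hl : ∀ x ∈ Ioo u v, x ≤ m → ‖f x - f m‖ ≤ -(g * (x - m) + d * (x - m) ^ 2) := by
    intro x hx h
    have h1 := m1 hx hmI h
    have h2 := m2 hx hmI h
    simp at h1 h2
    rw [Real.norm_eq_abs, abs_le]
    constructor <;> linarith
  have hcP : Continuous (fun x : ℝ => g * (x - m) + d * (x - m) ^ 2) := by fun_prop
  have hint : IntervalIntegrable (fun x => f x - f m) volume u v := by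
    rw [intervalIntegrable_iff_integrableOn_Ioo_of_le huv.le]
    have hc : IntegrableOn (fun x : ℝ => |g * (x - m) + d * (x - m) ^ 2|) (Ioo u v) :=
      (hcP.abs.integrableOn_Icc).mono_set Ioo_subset_Icc_self
    refine Integrable.mono' hc ?_ ?_
    · refine ContinuousOn.aestronglyMeasurable ?_ measurableSet_Ioo
      exact fun x hx => ((hf x hx).continuousAt.continuousWithinAt).sub continuousWithinAt_const
    · refine (ae_restrict_iff' measurableSet_Ioo).2 (Filter.Eventually.of_forall fun x hx => ?_)
      rcases le_total m x with h | h
      · exact (hr x hx h).trans (le_abs_self _)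
      · exact (hl x hx h).trans (neg_le_abs _)
  have hil := hint.mono_set (c := u) (d := m)
    (by rw [uIcc_of_le hum.le, uIcc_of_le huv.le]; exact Icc_subset_Icc_right hmv.le)
  have hir := hint.mono_set (c := m) (d := v)
    (by rw [uIcc_of_le hmv.le, uIcc_of_le huv.le]; exact Icc_subset_Icc_left hum.le)
  have e1 : ‖∫ x in u..m, (f x - f m)‖ ≤ ∫ x in u..m, -(g * (x - m) + d * (x - m) ^ 2) := by
    apply norm_integral_le_of_norm_le hum.le
    · refine Filter.Eventually.of_forall fun x hx => ?_
      exact hl x ⟨hx.1, hx.2.trans_lt hmv⟩ hx.2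
    · exact hcP.neg.intervalIntegrable _ _
  have e2 : ‖∫ x in m..v, (f x - f m)‖ ≤ ∫ x in m..v, (g * (x - m) + d * (x - m) ^ 2) := by
    apply norm_integral_le_of_norm_le hmv.le
    · have hne : ∀ᵐ x : ℝ, x ≠ v := by simp [ae_iff]
      filter_upwards [hne] with x hxv hx
      exact hr x ⟨hum.trans hx.1, lt_of_le_of_ne hx.2 hxv⟩ hx.1.le
    · exact hcP.intervalIntegrable _ _
  rw [intervalIntegral.integral_neg, aux_int_s11] at e1
  rw [aux_int_s11] at e2
  have hsum := integral_add_adjacent_intervals hil hir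
  have hf_int : IntervalIntegrable f volume u v := by
    have := hint.add (intervalIntegrable_const (c := f m))
    refine this.congr ?_
    intro x _
    simp
  have hsub : ∫ x in u..v, (f x - f m) = (∫ x in u..v, f x) - (v - u) * f m := by
    rw [intervalIntegral.integral_sub hf_int intervalIntegrable_const]
    simp
  have key : |(∫ x in u..v, f x) - (v - u) * f m| ≤ (v - u) ^ 2 * (A + B) / 8 := by
    rw [← hsub, ← hsum]
    refine (abs_add_le _ _).trans ?_
    rw [Real.norm_eq_abs] at e1 e2
    refine (add_le_add e1 e2).trans (le_of_eq ?_)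
    rw [hm, hg]
    ring
  have e : (1 / (v - u)) * (∫ x in u..v, f x) - f m
      = ((∫ x in u..v, f x) - (v - u) * f m) / (v - u) := by
    field_simp
  rw [e, abs_div, abs_of_pos hL, div_le_iff₀ hL]
  linarith


open MeasureTheory Set intervalIntegral

theorem stmt11
    (I : Set ℝ) (hI : Convex ℝ I) (a b : ℝ) (ha : a ∈ I) (hb : b ∈ I)
    (hab : a < b) (f f' φ : ℝ → ℝ)
    (hf : ∀ x ∈ interior I, HasDerivAt f (f' x) x)
    (hf'int : MeasureTheory.IntegrableOn f' (Set.Icc a b))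
    (hφmap : ∀ x ∈ Set.Icc a b, φ x ∈ Set.Icc a b)
    (hφcont : ContinuousOn φ (Set.Icc a b))
    (hφab : φ a < φ b)
    (c : ℝ) (hc : 0 < c)
    (hconv : StronglyPhiHConvexOn a b φ (fun t => t) c (fun x => |f' x|)) :
    |(1 / (φ b - φ a)) * (∫ x in φ a..φ b, f x) - f ((φ a + φ b) / 2)| ≤
      (φ b - φ a) * (|f' (φ a)| + |f' (φ b)|) / 8 := by
  have hua := hφmap a ⟨le_rfl, hab.le⟩
  have hub := hφmap b ⟨hab.le, le_rfl⟩
  have hL : 0 < φ b - φ a := by linarith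
  have hsub : Ioo (φ a) (φ b) ⊆ interior I := by
    apply interior_maximal _ isOpen_Ioo
    intro x hx
    exact hI.ordConnected.out ha hb ⟨hua.1.trans hx.1.le, hx.2.le.trans hub.2⟩
  apply aux_main _ _ hφab f f' _ _ (fun x hx => hf x (hsub hx))
  intro x hx
  have ht : (φ b - x) / (φ b - φ a) ∈ Ioo (0:ℝ) 1 := by
    constructor
    · exact div_pos (by linarith [hx.2]) hL
    · rw [div_lt_one hL]; linarith [hx.1]
  have h := hconv a ⟨le_rfl, hab.le⟩ b ⟨hab.le, le_rfl⟩ _ ht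
  obtain ⟨t, htd⟩ : ∃ t, t = (φ b - x) / (φ b - φ a) := ⟨_, rfl⟩
  rw [← htd] at h ht
  have hx' : t * φ a + (1 - t) * φ b = x := by
    rw [htd]; field_simp; ring
  have hpos : 0 ≤ c * t * (1 - t) * (φ a - φ b) ^ 2 := by
    have h1 := ht.1
    have h2 : 0 < 1 - t := by linarith [ht.2]
    positivity
  simp only [hx'] at h
  have e : (|f' (φ a)| + |f' (φ b)|) / 2 + (|f' (φ b)| - |f' (φ a)|) / (φ b - φ a) * (x - (φ a + φ b) / 2)
      = t * |f' (φ a)| + (1 - t) * |f' (φ b)| := by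
    rw [htd]; field_simp; ring
  rw [e]
  linarith
end

section
/- Let s ∈ (0,1), let f : I → ℝ be differentiable on the interior I° of an interval I ⊆ ℝ with a, b ∈ I, a < b, and f′ Lebesgue integrable, and let φ : [a,b] → [a,b] be continuous with φ(a) < φ(b). If |f′| is strongly φ_s-convex with modulus c > 0 (i.e. strongly φ_h-convex with h(t) = t^s), then |(1/(φ(b) − φ(a))) ∫_{φ(a)}^{φ(b)} f(x) dx − f((φ(a) + φ(b))/2)| ≤ (φ(b) − φ(a)) · ((1 − 2^{−(s+1)})/((s+1)(s+2))) · (|f′(φ(a))| + |f′(φ(b))|). -/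
open MeasureTheory Set intervalIntegral

theorem aux12 (s : ℝ) (hs : 0 < s) (L A B : ℝ) (hL : 0 < L) (hA : 0 ≤ A) (hB : 0 ≤ B)
    (g g' : ℝ → ℝ) (hg : ∀ t ∈ Set.Ioo (0:ℝ) 1, HasDerivAt g (g' t) t)
    (hb : ∀ t ∈ Set.Ioo (0:ℝ) 1, |g' t| ≤ L * (t ^ s * B + (1 - t) ^ s * A)) :
    |(∫ t in (0:ℝ)..1, g t) - g (1/2)| ≤
      L * ((1 - (2:ℝ) ^ (-(s + 1))) / ((s + 1) * (s + 2))) * (A + B) := by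
  set H : ℝ → ℝ := fun t => L / (s+1) * (t ^ (s+1) * B - (1 - t) ^ (s+1) * A) with hH
  have hp1 : Continuous (fun t : ℝ => t ^ (s+1)) :=
    continuous_id.rpow_const (fun x => Or.inr (by linarith))
  have hp2 : Continuous (fun t : ℝ => (1-t) ^ (s+1)) :=
    hp1.comp (continuous_const.sub continuous_id)
  have hHc : Continuous H := by
    simp only [hH]; fun_prop
  have hHd : ∀ t ∈ Set.Ioo (0:ℝ) 1, HasDerivAt H (L * (t ^ s * B + (1 - t) ^ s * A)) t := by
    intro t ht
    have h1 : HasDerivAt (fun t : ℝ => t ^ (s+1)) ((s+1) * t ^ s) t := by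
      have := Real.hasDerivAt_rpow_const (x := t) (p := s+1) (Or.inl ht.1.ne')
      simpa using this
    have h2 : HasDerivAt (fun t : ℝ => (1-t) ^ (s+1)) (-((s+1) * (1-t) ^ s)) t := by
      have h3 := Real.hasDerivAt_rpow_const (x := 1-t) (p := s+1)
        (Or.inl (sub_pos.2 ht.2).ne')
      have h4 : HasDerivAt (fun t : ℝ => 1 - t) (-1) t := by
        simpa using (hasDerivAt_id t).const_sub 1
      have := h3.comp t h4
      simpa [Function.comp_def] using this
    have h5 := ((h1.mul_const B).sub (h2.mul_const A)).const_mul (L/(s+1))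
    refine h5.congr_deriv ?_
    have : s + 1 ≠ 0 := by linarith
    field_simp
    ring
  have hm1 : MonotoneOn (fun t => H t - g t) (Set.Ioo 0 1) := by
    apply monotoneOn_of_hasDerivWithinAt_nonneg (convex_Ioo 0 1)
      (f' := fun t => L * (t ^ s * B + (1 - t) ^ s * A) - g' t)
    · intro t ht
      exact ((hHd t ht).sub (hg t ht)).continuousAt.continuousWithinAt
    · intro t ht
      rw [interior_Ioo] at ht
      exact ((hHd t ht).sub (hg t ht)).hasDerivWithinAt
    · intro t ht
      rw [interior_Ioo] at ht
      have := (abs_le.1 (hb t ht)).2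
      linarith
  have hm2 : MonotoneOn (fun t => H t + g t) (Set.Ioo 0 1) := by
    apply monotoneOn_of_hasDerivWithinAt_nonneg (convex_Ioo 0 1)
      (f' := fun t => L * (t ^ s * B + (1 - t) ^ s * A) + g' t)
    · intro t ht
      exact ((hHd t ht).add (hg t ht)).continuousAt.continuousWithinAt
    · intro t ht
      rw [interior_Ioo] at ht
      exact ((hHd t ht).add (hg t ht)).hasDerivWithinAt
    · intro t ht
      rw [interior_Ioo] at ht
      have := (abs_le.1 (hb t ht)).1
      linarith
  have hhalf : (1/2:ℝ) ∈ Set.Ioo (0:ℝ) 1 := by constructor <;> norm_num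
  have hlow : ∀ t ∈ Set.Ioo (0:ℝ) 1, t ≤ 1/2 → |g t - g (1/2)| ≤ H (1/2) - H t := by
    intro t ht h
    have a1 := hm1 ht hhalf h
    have a2 := hm2 ht hhalf h
    simp only at a1 a2
    rw [abs_le]; constructor <;> linarith
  have hhigh : ∀ t ∈ Set.Ioo (0:ℝ) 1, 1/2 ≤ t → |g t - g (1/2)| ≤ H t - H (1/2) := by
    intro t ht h
    have a1 := hm1 hhalf ht h
    have a2 := hm2 hhalf ht h
    simp only at a1 a2
    rw [abs_le]; constructor <;> linarith
  have hbd : ∀ t ∈ Set.Ioo (0:ℝ) 1, |g t - g (1/2)| ≤ |H t - H (1/2)| := by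
    intro t ht
    rcases le_total t (1/2) with h | h
    · rw [abs_sub_comm (H t)]
      exact (hlow t ht h).trans (le_abs_self _)
    · exact (hhigh t ht h).trans (le_abs_self _)
  have hbc : Continuous (fun t => |H t - H (1/2)|) := (hHc.sub continuous_const).abs
  have hae : ∀ᵐ t : ℝ, t ∈ Set.Ioc (0:ℝ) 1 → ‖g t - g (1/2)‖ ≤ |H t - H (1/2)| := by
    have : ∀ᵐ t : ℝ, t ≠ 1 := by
      simp [ae_iff]
    filter_upwards [this] with t ht ht'
    exact hbd t ⟨ht'.1, lt_of_le_of_ne ht'.2 ht⟩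
  have hgi : IntervalIntegrable (fun t => g t - g (1/2)) volume 0 1 := by
    rw [intervalIntegrable_iff_integrableOn_Ioo_of_le zero_le_one]
    have hb1 : IntegrableOn (fun t => |H t - H (1/2)|) (Set.Ioo 0 1) volume :=
      (intervalIntegrable_iff_integrableOn_Ioo_of_le zero_le_one).1 (hbc.intervalIntegrable 0 1)
    refine Integrable.mono' hb1 ?_ ?_
    · apply ContinuousOn.aestronglyMeasurable _ measurableSet_Ioo
      intro t ht
      exact ((hg t ht).continuousAt.sub continuousAt_const).continuousWithinAt
    · rw [ae_restrict_iff' measurableSet_Ioo]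
      exact Filter.Eventually.of_forall hbd
  have hgi2 : IntervalIntegrable g volume 0 1 := by
    simpa using hgi.add (intervalIntegrable_const (c := g (1/2)))
  have e1 : (∫ t in (0:ℝ)..1, g t) - g (1/2) = ∫ t in (0:ℝ)..1, (g t - g (1/2)) := by
    rw [intervalIntegral.integral_sub hgi2 intervalIntegrable_const]
    simp
  have e2 : |∫ t in (0:ℝ)..1, (g t - g (1/2))| ≤ ∫ t in (0:ℝ)..1, |H t - H (1/2)| := 
    intervalIntegral.norm_integral_le_of_norm_le zero_le_one hae (hbc.intervalIntegrable 0 1)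
  have hHmono : MonotoneOn H (Set.Icc 0 1) := by
    apply monotoneOn_of_hasDerivWithinAt_nonneg (convex_Icc 0 1)
      (f' := fun t => L * (t ^ s * B + (1 - t) ^ s * A)) hHc.continuousOn
    · intro t ht
      rw [interior_Icc] at ht
      exact (hHd t ht).hasDerivWithinAt
    · intro t ht
      rw [interior_Icc] at ht
      exact (abs_nonneg _).trans (hb t ht)
  have i1 : ∫ t in (0:ℝ)..(1/2), |H t - H (1/2)| = ∫ t in (0:ℝ)..(1/2), (H (1/2) - H t) := by
    apply intervalIntegral.integral_congr
    intro t ht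
    rw [uIcc_of_le (by norm_num)] at ht
    have := hHmono (a := t) (b := 1/2) ⟨ht.1, by linarith [ht.2]⟩ (by constructor <;> norm_num) ht.2
    simp only
    rw [abs_sub_comm, abs_of_nonneg (by linarith)]
  have i2 : ∫ t in (1/2:ℝ)..1, |H t - H (1/2)| = ∫ t in (1/2:ℝ)..1, (H t - H (1/2)) := by
    apply intervalIntegral.integral_congr
    intro t ht
    rw [uIcc_of_le (by norm_num)] at ht
    have := hHmono (a := 1/2) (b := t) (by constructor <;> norm_num) ⟨by linarith [ht.1], ht.2⟩ ht.1
    simp only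
    rw [abs_of_nonneg (by linarith)]
  have i3 : ∀ u v : ℝ, ∫ t in u..v, H t = L/(s+1) *
      ((v^(s+2) - u^(s+2))/(s+2) * B - ((1-u)^(s+2) - (1-v)^(s+2))/(s+2) * A) := by
    intro u v
    have j1 : ∀ u v : ℝ, ∫ t in u..v, t ^ (s+1) = (v^(s+2) - u^(s+2))/(s+2) := by
      intro u v
      rw [integral_rpow (Or.inl (by linarith))]
      ring_nf
    have j2 : ∫ t in u..v, (1-t) ^ (s+1) = ((1-u)^(s+2) - (1-v)^(s+2))/(s+2) := by
      rw [intervalIntegral.integral_comp_sub_left (fun t => t ^ (s+1)) 1, j1]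
    have m1 : IntervalIntegrable (fun t : ℝ => t ^ (s+1) * B) volume u v :=
      (hp1.mul continuous_const).intervalIntegrable _ _
    have m2 : IntervalIntegrable (fun t : ℝ => (1-t) ^ (s+1) * A) volume u v :=
      (hp2.mul continuous_const).intervalIntegrable _ _
    simp only [hH]
    rw [intervalIntegral.integral_const_mul, intervalIntegral.integral_sub m1 m2,
      intervalIntegral.integral_mul_const, intervalIntegral.integral_mul_const, j1, j2]
  rw [e1]
  refine e2.trans (le_of_eq ?_)
  rw [← intervalIntegral.integral_add_adjacent_intervals (hbc.intervalIntegrable 0 (1/2))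
    (hbc.intervalIntegrable (1/2) 1), i1, i2,
    intervalIntegral.integral_sub intervalIntegrable_const (hHc.intervalIntegrable _ _),
    intervalIntegral.integral_sub (hHc.intervalIntegrable _ _) intervalIntegrable_const, i3, i3]
  have k1 : (1/2:ℝ)^(s+2) = (2:ℝ) ^ (-(s + 1)) / 2 := by
    rw [show s + 2 = (s+1) + 1 by ring, Real.rpow_add_one (by norm_num),
      Real.rpow_neg (by norm_num), one_div, Real.inv_rpow (by norm_num)]
    ring
  have k2 : (0:ℝ)^(s+2) = 0 := Real.zero_rpow (by linarith)
  have k3 : (1 - 1/2 : ℝ) = 1/2 := by norm_num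
  have n1 : s + 1 ≠ 0 := by linarith
  have n2 : s + 2 ≠ 0 := by linarith
  simp only [k3, sub_self, sub_zero, k1, k2, Real.one_rpow, intervalIntegral.integral_const,
    smul_eq_mul]
  field_simp
  ring

theorem stmt12 (s : ℝ) (hs : s ∈ Set.Ioo (0:ℝ) 1)
    (I : Set ℝ) (hI : Convex ℝ I) (a b : ℝ) (ha : a ∈ I) (hb : b ∈ I)
    (hab : a < b) (f f' φ : ℝ → ℝ)
    (hf : ∀ x ∈ interior I, HasDerivAt f (f' x) x)
    (hf'int : MeasureTheory.IntegrableOn f' (Set.Icc a b))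
    (hφmap : ∀ x ∈ Set.Icc a b, φ x ∈ Set.Icc a b)
    (hφcont : ContinuousOn φ (Set.Icc a b))
    (hφab : φ a < φ b)
    (c : ℝ) (hc : 0 < c)
    (hconv : StronglyPhiHConvexOn a b φ (fun t => t ^ s) c (fun x => |f' x|)) :
    |(1 / (φ b - φ a)) * (∫ x in φ a..φ b, f x) - f ((φ a + φ b) / 2)| ≤
      (φ b - φ a) * ((1 - (2:ℝ) ^ (-(s + 1))) / ((s + 1) * (s + 2))) *
        (|f' (φ a)| + |f' (φ b)|) := by
  have hL : 0 < φ b - φ a := sub_pos.2 hφab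
  have haI : a ∈ Set.Icc a b := ⟨le_rfl, hab.le⟩
  have hbI : b ∈ Set.Icc a b := ⟨hab.le, le_rfl⟩
  have hpa := hφmap a haI
  have hpb := hφmap b hbI
  have hsub : Set.Ioo a b ⊆ interior I :=
    interior_maximal (Ioo_subset_Icc_self.trans (hI.ordConnected.out ha hb)) isOpen_Ioo
  have key := aux12 s hs.1 (φ b - φ a) |f' (φ a)| |f' (φ b)| hL (abs_nonneg _) (abs_nonneg _)
    (fun t => f ((φ b - φ a) * t + φ a))
    (fun t => f' ((φ b - φ a) * t + φ a) * (φ b - φ a)) ?_ ?_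
  · convert key using 3
    · rw [intervalIntegral.integral_comp_mul_add (fun x => f x) hL.ne' (φ a)]
      simp
    · ring_nf
  · intro t ht
    have h1 : HasDerivAt (fun t : ℝ => (φ b - φ a) * t + φ a) (φ b - φ a) t := by
      simpa using ((hasDerivAt_id t).const_mul (φ b - φ a)).add_const (φ a)
    refine HasDerivAt.comp t (hf _ (hsub ⟨?_, ?_⟩)) h1
    · have := mul_pos hL ht.1
      linarith [hpa.1]
    · have := mul_pos hL (sub_pos.2 ht.2)
      linarith [hpb.2]
  · intro t ht
    have h := hconv b hbI a haI t ht
    simp only at h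
    have e : t * φ b + (1 - t) * φ a = (φ b - φ a) * t + φ a := by ring
    rw [e] at h
    have h0 : 0 ≤ c * t * (1 - t) * (φ b - φ a) ^ 2 := by
      have := ht.1.le
      have := sub_nonneg.2 ht.2.le
      positivity
    rw [abs_mul, abs_of_pos hL, mul_comm]
    exact mul_le_mul_of_nonneg_left (by linarith) hL.le
end

section
/- Let f : I → ℝ be differentiable on the interior I° of an interval I ⊆ ℝ with a, b ∈ I, a < b, and f′ Lebesgue integrable, and let φ : [a,b] → [a,b] be continuous with φ(a) < φ(b). If |f′| is a strongly φ-P-function with modulus c > 0 (i.e. strongly φ_h-convex with h(t) = 1), then |(1/(φ(b) − φ(a))) ∫_{φ(a)}^{φ(b)} f(x) dx − f((φ(a) + φ(b))/2)| ≤ (φ(b) − φ(a)) (|f′(φ(a))| + |f′(φ(b))|)/4. -/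
open MeasureTheory Set intervalIntegral

theorem stmt13
    (I : Set ℝ) (hI : Convex ℝ I) (a b : ℝ) (ha : a ∈ I) (hb : b ∈ I)
    (hab : a < b) (f f' φ : ℝ → ℝ)
    (hf : ∀ x ∈ interior I, HasDerivAt f (f' x) x)
    (hf'int : MeasureTheory.IntegrableOn f' (Set.Icc a b))
    (hφmap : ∀ x ∈ Set.Icc a b, φ x ∈ Set.Icc a b)
    (hφcont : ContinuousOn φ (Set.Icc a b))
    (hφab : φ a < φ b)
    (c : ℝ) (hc : 0 < c)
    (hconv : StronglyPhiHConvexOn a b φ (fun _ => 1) c (fun x => |f' x|)) :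
    |(1 / (φ b - φ a)) * (∫ x in φ a..φ b, f x) - f ((φ a + φ b) / 2)| ≤
      (φ b - φ a) * (|f' (φ a)| + |f' (φ b)|) / 4 := by
  have hsub : Set.Ioo (φ a) (φ b) ⊆ interior I := by
    have h1 := (hφmap a (left_mem_Icc.2 hab.le)).1
    have h2 := (hφmap b (right_mem_Icc.2 hab.le)).2
    have h3 : Set.Icc a b ⊆ I := hI.ordConnected.out ha hb
    have h4 : Set.Ioo a b ⊆ interior I :=
      interior_maximal (Ioo_subset_Icc_self.trans h3) isOpen_Ioo
    exact (Ioo_subset_Ioo h1 h2).trans h4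
  have hbd0 : ∀ x ∈ Set.Ioo (φ a) (φ b), |f' x| ≤ |f' (φ a)| + |f' (φ b)| := by
    intro x hx
    have hd : 0 < φ b - φ a := sub_pos.2 hφab
    set t := (φ b - x) / (φ b - φ a) with ht
    have ht0 : 0 < t := div_pos (sub_pos.2 hx.2) hd
    have ht1 : t < 1 := by rw [ht, div_lt_one hd]; linarith [hx.1]
    have hk := hconv a (left_mem_Icc.2 hab.le) b (right_mem_Icc.2 hab.le) t ⟨ht0, ht1⟩
    have he : t * φ a + (1 - t) * φ b = x := by
      rw [ht]; field_simp; ring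
    simp only [he, one_mul] at hk
    have : 0 ≤ c * t * (1 - t) * (φ a - φ b) ^ 2 := by
      have : 0 < 1 - t := by linarith
      positivity
    linarith
  generalize |f' (φ a)| + |f' (φ b)| = K at *
  generalize φ a = u at *
  generalize φ b = v at *
  have hd : 0 < v - u := sub_pos.2 hφab
  set m := (u + v) / 2 with hm
  have hum : u < m := by rw [hm]; linarith
  have hmv : m < v := by rw [hm]; linarith
  have hlip : ∀ x ∈ Set.Ioo u v, |f x - f m| ≤ K * |x - m| := by
    intro x hx
    exact (convex_Ioo u v).norm_image_sub_le_of_norm_hasDerivWithin_le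
      (f := f) (f' := f') (fun y hy => (hf y (hsub hy)).hasDerivWithinAt)
      (fun y hy => hbd0 y hy) ⟨hum, hmv⟩ hx
  have hK : 0 ≤ K := (abs_nonneg _).trans (hbd0 m ⟨hum, hmv⟩)
  have hae : ∀ᵐ x : ℝ, x ≠ v := by simp [ae_iff]
  have hfi : IntervalIntegrable f volume u v := by
    rw [intervalIntegrable_iff_integrableOn_Ioo_of_le hφab.le]
    have hc : ContinuousOn f (Set.Ioo u v) :=
      fun x hx => (hf x (hsub hx)).continuousAt.continuousWithinAt
    refine Integrable.of_bound
      (hc.aestronglyMeasurable measurableSet_Ioo) (|f m| + K * (v - u)) ?_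
    refine (ae_restrict_iff' measurableSet_Ioo).2 (Filter.Eventually.of_forall fun x hx => ?_)
    have h1 := hlip x hx
    have h2 : |x - m| ≤ v - u := by
      rw [abs_le]; constructor <;> linarith [hx.1, hx.2]
    have h3 := mul_le_mul_of_nonneg_left h2 hK
    have h4 := abs_sub_abs_le_abs_sub (f x) (f m)
    rw [Real.norm_eq_abs]; linarith
  have hgi : ∀ p q : ℝ, IntervalIntegrable (fun x => K * |x - m|) volume p q :=
    fun p q => (by fun_prop : Continuous fun x => K * |x - m|).intervalIntegrable _ _
  have hI1 : ∫ x in u..v, (f x - f m) = (∫ x in u..v, f x) - (v - u) * f m := by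
    rw [intervalIntegral.integral_sub hfi (by simp)]; simp
  have hI2 : ∫ x in u..v, K * |x - m| = K * ((v - u) ^ 2 / 4) := by
    rw [← intervalIntegral.integral_add_adjacent_intervals (hgi u m) (hgi m v)]
    have e1 : ∫ x in u..m, K * |x - m| = ∫ x in u..m, K * (m - x) := by
      apply intervalIntegral.integral_congr
      intro x hx
      rw [uIcc_of_le hum.le] at hx
      simp only
      rw [abs_of_nonpos (by linarith [hx.2])]; ring
    have e2 : ∫ x in m..v, K * |x - m| = ∫ x in m..v, K * (x - m) := by
      apply intervalIntegral.integral_congr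
      intro x hx
      rw [uIcc_of_le hmv.le] at hx
      simp only
      rw [abs_of_nonneg (by linarith [hx.1])]
    rw [e1, e2, intervalIntegral.integral_const_mul, intervalIntegral.integral_const_mul,
      intervalIntegral.integral_sub (by simp) (by simp),
      intervalIntegral.integral_sub (by simp) (by simp)]
    simp only [intervalIntegral.integral_const, integral_id, smul_eq_mul]
    rw [hm]; ring
  have hmain : |∫ x in u..v, (f x - f m)| ≤ K * ((v - u) ^ 2 / 4) := by
    rw [← hI2, ← Real.norm_eq_abs]
    refine intervalIntegral.norm_integral_le_of_norm_le hφab.le ?_ (hgi u v)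
    filter_upwards [hae] with x hx hx2
    exact hlip x ⟨hx2.1, lt_of_le_of_ne hx2.2 hx⟩
  have e : 1 / (v - u) * (∫ x in u..v, f x) - f m = (∫ x in u..v, (f x - f m)) / (v - u) := by
    rw [hI1]; field_simp
  rw [e, abs_div, abs_of_pos hd, div_le_iff₀ hd]
  linarith
end

section
/- Let h : (0,1) → (0,∞) be Lebesgue integrable, let q > 1 and p > 1 satisfy 1/p + 1/q = 1, let f : I → ℝ be differentiable on the interior I° of an interval I ⊆ ℝ with a, b ∈ I, a < b, and f′ Lebesgue integrable, and let φ : [a,b] → [a,b] be continuous with φ(a) < φ(b). Suppose |f′|^q is strongly φ_h-convex with modulus c > 0, and set G = c^q (φ(b) − φ(a))^{2q} B_{1/2}(q+1, q+1) − (c/12)(φ(b) − φ(a))², where B_{1/2}(q+1, q+1) = ∫_0^{1/2} t^q (1 − t)^q dt is the incomplete Beta function. If G > 0, then |(1/(φ(b) − φ(a))) ∫_{φ(a)}^{φ(b)} f(x) dx − f((φ(a) + φ(b))/2)| ≤ ((φ(b) − φ(a))/2) (1/(p+1))^{1/p} { ( ∫_0^{1/2} (h(t) |f′(φ(a))|^q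 + h(1 − t) |f′(φ(b))|^q) dt + G )^{1/q} + ( ∫_{1/2}^1 (h(t) |f′(φ(a))|^q + h(1 − t) |f′(φ(b))|^q) dt + G )^{1/q} }. -/
open MeasureTheory Set intervalIntegral

lemma parts_aux (k k' : ℝ → ℝ) (hk : ∀ t ∈ Ioc (0:ℝ) (1/2), HasDerivAt k (k' t) t)
    (hi : IntervalIntegrable k' volume 0 (1/2)) :
    IntervalIntegrable k volume 0 (1/2) ∧
      ∫ t in (0:ℝ)..(1/2), t * k' t = 1/2 * k (1/2) - ∫ t in (0:ℝ)..(1/2), k t := by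
  have hc : ContinuousOn (fun t => k (1/2) + ∫ s in (1/2:ℝ)..t, k' s) (uIcc (0:ℝ) (1/2)) :=
    continuousOn_const.add
      (continuousOn_primitive_interval' hi right_mem_uIcc)
  have heq : ∀ t ∈ Ioc (0:ℝ) (1/2), k t = k (1/2) + ∫ s in (1/2:ℝ)..t, k' s := by
    intro t ht
    have hsub : uIcc (1/2:ℝ) t ⊆ Ioc (0:ℝ) (1/2) := by
      rw [uIcc_of_ge ht.2]
      intro x hx
      exact ⟨lt_of_lt_of_le ht.1 hx.1, hx.2⟩
    rw [integral_eq_sub_of_hasDerivAt (fun x hx => hk x (hsub hx))]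
    · ring
    · apply hi.mono_set
      rw [uIcc_of_le (by norm_num : (0:ℝ) ≤ 1/2)]
      exact hsub.trans Ioc_subset_Icc_self
  have hae : ∀ t ∈ uIoc (0:ℝ) (1/2), k t = k (1/2) + ∫ s in (1/2:ℝ)..t, k' s := by
    intro t ht
    rw [uIoc_of_le (by norm_num : (0:ℝ) ≤ 1/2)] at ht
    exact heq t ht
  refine ⟨hc.intervalIntegrable.congr (fun t ht => (hae t ht).symm), ?_⟩
  have h1 := integral_mul_deriv_eq_deriv_mul_of_hasDerivAt (u := fun t : ℝ => t) (u' := fun _ => 1)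
    (v' := k') continuousOn_id hc (fun x _ => hasDerivAt_id x) ?_ (by simp) hi
  · rw [h1, intervalIntegral.integral_congr_ae (g := fun t => 1 * (k (1/2) + ∫ s in (1/2:ℝ)..t, k' s))
      (f := k)]
    · simp
    · exact Filter.Eventually.of_forall fun t ht => by rw [hae t ht]; ring
  · intro x hx
    rw [min_eq_left (by norm_num), max_eq_right (by norm_num)] at hx
    refine (hk x ⟨hx.1, hx.2.le⟩).congr_of_eventuallyEq ?_
    filter_upwards [Ioo_mem_nhds hx.1 hx.2] with y hy
    exact (heq y ⟨hy.1, hy.2.le⟩).symm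

lemma holder_aux (p q : ℝ) (hp : 1 < p) (hq : 1 < q) (hpq : 1 / p + 1 / q = 1)
    (u H : ℝ → ℝ) (hu : IntervalIntegrable u volume 0 (1/2))
    (hH : IntervalIntegrable H volume 0 (1/2))
    (huH : ∀ t ∈ Ioc (0:ℝ) (1/2), |u t| ^ q ≤ H t) (G : ℝ) (hG : 0 < G) :
    |∫ t in (0:ℝ)..(1/2), t * u t| ≤
      (1/2) * (1 / (p + 1)) ^ (1 / p) * ((∫ t in (0:ℝ)..(1/2), H t) + G) ^ (1 / q) := by
  have h0 : (0:ℝ) ≤ 1/2 := by norm_num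
  have hp0 : 0 < p := by linarith
  have hq0 : 0 < q := by linarith
  have hc : p.HolderConjugate q := by
    rw [Real.holderConjugate_iff]
    exact ⟨hp, by simpa using hpq⟩
  have hu' := (intervalIntegrable_iff_integrableOn_Ioc_of_le h0).1 hu
  have hH' := (intervalIntegrable_iff_integrableOn_Ioc_of_le h0).1 hH
  have huq : IntegrableOn (fun t => ‖u t‖ ^ q) (Ioc 0 (1/2)) := by
    refine Integrable.mono' hH' ?_ ?_
    · exact (hu'.1.norm.aemeasurable.pow_const q).aestronglyMeasurable
    · filter_upwards [ae_restrict_mem measurableSet_Ioc] with t ht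
      rw [Real.norm_of_nonneg (by positivity)]
      exact huH t ht
  have hmu : MemLp u (ENNReal.ofReal q) (volume.restrict (Ioc 0 (1/2))) := by
    rw [← integrable_norm_rpow_iff hu'.1 (by simpa using hq0) ENNReal.ofReal_ne_top,
      ENNReal.toReal_ofReal hq0.le]
    exact huq
  have hmt : MemLp (fun t : ℝ => t) (ENNReal.ofReal p) (volume.restrict (Ioc 0 (1/2))) := by
    refine MemLp.of_bound (by fun_prop) (1/2) ?_
    filter_upwards [ae_restrict_mem measurableSet_Ioc] with t ht
    rw [Real.norm_of_nonneg ht.1.le]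
    exact ht.2
  have key := integral_mul_norm_le_Lp_mul_Lq hc hmt hmu
  have e1 : ∫ t in Ioc (0:ℝ) (1/2), ‖t‖ ^ p = (1/2) ^ (p+1) / (p+1) := by
    rw [setIntegral_congr_fun (g := fun t => t ^ p) measurableSet_Ioc
      (fun t ht => by simp only [Real.norm_of_nonneg ht.1.le]),
      ← intervalIntegral.integral_of_le h0, integral_rpow (Or.inl (by linarith)),
      Real.zero_rpow (by linarith), sub_zero]
  have e2 : ((1/2:ℝ) ^ (p+1) / (p+1)) ^ (1/p) ≤ (1/2) * (1 / (p + 1)) ^ (1 / p) := by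
    have : (1/2:ℝ) ^ (p+1) ≤ (1/2) ^ p :=
      Real.rpow_le_rpow_of_exponent_ge (by norm_num) (by norm_num) (by linarith)
    calc _ ≤ ((1/2:ℝ) ^ p * (1 / (p+1))) ^ (1/p) := by
          apply Real.rpow_le_rpow (by positivity) _ (by positivity)
          rw [div_eq_mul_one_div]
          gcongr
      _ = _ := by
          rw [Real.mul_rpow (by positivity) (by positivity), ← Real.rpow_mul (by norm_num),
            mul_one_div_cancel hp0.ne', Real.rpow_one]
  have e3 : ∫ t in Ioc (0:ℝ) (1/2), ‖u t‖ ^ q ≤ (∫ t in (0:ℝ)..(1/2), H t) + G := by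
    rw [intervalIntegral.integral_of_le h0]
    have := setIntegral_mono_on huq hH' measurableSet_Ioc huH
    linarith
  have e4 : 0 ≤ ∫ t in Ioc (0:ℝ) (1/2), ‖u t‖ ^ q := integral_nonneg (fun t => by positivity)
  rw [e1] at key
  calc _ ≤ ∫ t in Ioc (0:ℝ) (1/2), ‖t‖ * ‖u t‖ := by
        rw [intervalIntegral.integral_of_le h0]
        simp_rw [← norm_mul]
        exact MeasureTheory.norm_integral_le_integral_norm (fun t => t * u t)
    _ ≤ _ := key
    _ ≤ _ := by gcongr

theorem stmt14 (h : ℝ → ℝ) (hhpos : ∀ t ∈ Set.Ioo (0:ℝ) 1, 0 < h t)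
    (hhint : MeasureTheory.IntegrableOn h (Set.Ioo 0 1))
    (p q : ℝ) (hp : 1 < p) (hq : 1 < q) (hpq : 1 / p + 1 / q = 1)
    (I : Set ℝ) (hI : Convex ℝ I) (a b : ℝ) (ha : a ∈ I) (hb : b ∈ I)
    (hab : a < b) (f f' φ : ℝ → ℝ)
    (hf : ∀ x ∈ interior I, HasDerivAt f (f' x) x)
    (hf'int : MeasureTheory.IntegrableOn f' (Set.Icc a b))
    (hφmap : ∀ x ∈ Set.Icc a b, φ x ∈ Set.Icc a b)
    (hφcont : ContinuousOn φ (Set.Icc a b))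
    (hφab : φ a < φ b)
    (c : ℝ) (hc : 0 < c)
    (hconv : StronglyPhiHConvexOn a b φ h c (fun x => |f' x| ^ q))
    (G : ℝ)
    (hG : G = c ^ q * (φ b - φ a) ^ (2 * q) *
        (∫ t in (0:ℝ)..(1/2), t ^ q * (1 - t) ^ q) - (c / 12) * (φ b - φ a) ^ 2)
    (hGpos : 0 < G) :
    |(1 / (φ b - φ a)) * (∫ x in φ a..φ b, f x) - f ((φ a + φ b) / 2)| ≤
      ((φ b - φ a) / 2) * (1 / (p + 1)) ^ (1 / p) *
        (((∫ t in (0:ℝ)..(1/2), h t * |f' (φ a)| ^ q + h (1 - t) * |f' (φ b)| ^ q) + G) ^ (1 / q) +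
          ((∫ t in (1/2:ℝ)..1, h t * |f' (φ a)| ^ q + h (1 - t) * |f' (φ b)| ^ q) + G) ^ (1 / q)) := by
  set A := φ a with hA
  set B := φ b with hB
  have hAm : A ∈ Icc a b := hφmap a ⟨le_rfl, hab.le⟩
  have hBm : B ∈ Icc a b := hφmap b ⟨hab.le, le_rfl⟩
  have hL : 0 < B - A := by linarith
  set L := B - A with hLdef
  have hder : ∀ x ∈ Ioo A B, HasDerivAt f (f' x) x := by
    intro x hx
    apply hf
    have hs : Ioo a b ⊆ interior I :=
      interior_maximal (Ioo_subset_Icc_self.trans (hI.ordConnected.out ha hb)) isOpen_Ioo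
    exact hs ⟨lt_of_le_of_lt hAm.1 hx.1, lt_of_lt_of_le hx.2 hBm.2⟩
  have hf'AB : IntervalIntegrable f' volume A B := by
    rw [intervalIntegrable_iff_integrableOn_Icc_of_le hφab.le]
    exact hf'int.mono_set (Icc_subset_Icc hAm.1 hBm.2)
  have hu1 : IntervalIntegrable (fun t => f' (A + L * t)) volume 0 1 := by
    have h1 := (hf'AB.comp_add_left A).comp_mul_left (c := L)
    rw [sub_self, zero_div, ← hLdef, div_self hL.ne'] at h1
    exact h1
  have hu2 : IntervalIntegrable (fun t => f' (B - L * t)) volume 0 1 := by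
    have h1 := (hu1.comp_sub_left 1).symm
    simp only [sub_self, sub_zero] at h1
    refine h1.congr (fun t _ => ?_)
    congr 1
    rw [hLdef]; ring
  have hsub : uIcc (0:ℝ) (1/2) ⊆ uIcc 0 1 := by
    rw [uIcc_of_le (by norm_num), uIcc_of_le (by norm_num)]
    exact Icc_subset_Icc le_rfl (by norm_num)
  have hsub' : uIcc (1/2:ℝ) 1 ⊆ uIcc 0 1 := by
    rw [uIcc_of_le (by norm_num), uIcc_of_le (by norm_num)]
    exact Icc_subset_Icc (by norm_num) le_rfl
  have hu1h := hu1.mono_set hsub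
  have hu2h := hu2.mono_set hsub
  -- integration by parts
  obtain ⟨i1, p1⟩ := parts_aux (fun t => f (A + L * t)) (fun t => L * f' (A + L * t))
    (by
      intro t ht
      have hx : A + L * t ∈ Ioo A B := by
        constructor
        · nlinarith [ht.1]
        · have : L * t ≤ L * (1/2) := mul_le_mul_of_nonneg_left ht.2 hL.le
          linarith
      have := (hder _ hx).comp t (((hasDerivAt_id t).const_mul L).const_add A)
      simpa [mul_comm, Function.comp_def] using this)
    (hu1h.const_mul L)
  obtain ⟨i2, p2⟩ := parts_aux (fun t => f (B - L * t)) (fun t => -L * f' (B - L * t))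
    (by
      intro t ht
      have hx : B - L * t ∈ Ioo A B := by
        constructor
        · have : L * t ≤ L * (1/2) := mul_le_mul_of_nonneg_left ht.2 hL.le
          linarith
        · nlinarith [ht.1]
      have := (hder _ hx).comp t (((hasDerivAt_id t).const_mul L).const_sub B)
      simpa [mul_comm, Function.comp_def] using this)
    (hu2h.const_mul (-L))
  have m1 : A + L * (1/2) = (A + B) / 2 := by rw [hLdef]; ring
  have m2 : B - L * (1/2) = (A + B) / 2 := by rw [hLdef]; ring
  have c1 : ∀ t, f (B - L * t) = f (A + L * (1 - t)) := by
    intro t; congr 1; rw [hLdef]; ring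
  have i2' : IntervalIntegrable (fun t => f (A + L * t)) volume (1/2) 1 := by
    have h1 := (i2.comp_sub_left 1).symm
    norm_num at h1
    refine IntervalIntegrable.congr (fun t _ => ?_) (by simpa using h1)
    rw [c1]; congr 2; ring
  have s2 : ∫ t in (0:ℝ)..(1/2), f (B - L * t) = ∫ t in (1/2:ℝ)..1, f (A + L * t) := by
    simp_rw [c1]
    rw [intervalIntegral.integral_comp_sub_left (fun t => f (A + L * t)) 1]
    norm_num
  have s3 : ∫ t in (0:ℝ)..1, f (A + L * t) = (1 / L) * ∫ x in A..B, f x := by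
    rw [intervalIntegral.integral_comp_add_mul _ hL.ne']
    rw [mul_zero, mul_one, add_zero, show A + L = B by rw [hLdef]; ring]
    simp
  have s4 := intervalIntegral.integral_add_adjacent_intervals i1 i2'
  set X1 := ∫ t in (0:ℝ)..(1/2), t * f' (A + L * t) with hX1
  set X2 := ∫ t in (0:ℝ)..(1/2), t * f' (B - L * t) with hX2
  have q1 : ∫ t in (0:ℝ)..(1/2), t * (L * f' (A + L * t)) = L * X1 := by
    rw [hX1, ← intervalIntegral.integral_const_mul]
    congr 1; ext t; ring
  have q2 : ∫ t in (0:ℝ)..(1/2), t * (-L * f' (B - L * t)) = -L * X2 := by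
    rw [hX2, ← intervalIntegral.integral_const_mul]
    congr 1; ext t; ring
  rw [q1] at p1
  rw [q2, s2] at p2
  simp only [m1] at p1
  simp only [m2] at p2
  have hmain : (1 / L) * (∫ x in A..B, f x) - f ((A + B) / 2) = L * (X2 - X1) := by
    rw [← s3, ← s4]; linarith
  -- the bounds
  have hh : IntervalIntegrable h volume 0 1 := by
    rw [intervalIntegrable_iff_integrableOn_Ioo_of_le zero_le_one]
    exact hhint
  have hh' : IntervalIntegrable (fun t => h (1 - t)) volume 0 1 := by
    have h1 := (hh.comp_sub_left 1).symm
    simpa only [sub_self, sub_zero] using h1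
  set H : ℝ → ℝ := fun t => h t * |f' A| ^ q + h (1 - t) * |f' B| ^ q with hH
  have hHi : IntervalIntegrable H volume 0 1 := (hh.mul_const _).add (hh'.mul_const _)
  have hHi' : IntervalIntegrable (fun t => H (1 - t)) volume 0 1 := by
    have h1 := (hHi.comp_sub_left 1).symm
    simpa only [sub_self, sub_zero] using h1
  have hbd : ∀ t ∈ Ioo (0:ℝ) 1, |f' (B - L * t)| ^ q ≤ H t := by
    intro t ht
    have h1 := hconv a ⟨le_rfl, hab.le⟩ b ⟨hab.le, le_rfl⟩ t ht
    simp only [← hA, ← hB] at h1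
    have e : B - L * t = t * A + (1 - t) * B := by rw [hLdef]; ring
    rw [e]
    have : 0 ≤ c * t * (1 - t) * (A - B) ^ 2 := by
      have := ht.1
      have : 0 < 1 - t := by linarith [ht.2]
      positivity
    simp only [hH]
    linarith
  have b2 := holder_aux p q hp hq hpq (fun t => f' (B - L * t)) H hu2h (hHi.mono_set hsub)
    (fun t ht => hbd t ⟨ht.1, by linarith [ht.2]⟩) G hGpos
  have b1 := holder_aux p q hp hq hpq (fun t => f' (A + L * t)) (fun t => H (1 - t)) hu1h
    (hHi'.mono_set hsub)
    (fun t ht => by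
      have := hbd (1 - t) ⟨by linarith [ht.2], by linarith [ht.1]⟩
      have e : B - L * (1 - t) = A + L * t := by rw [hLdef]; ring
      rwa [e] at this) G hGpos
  have e5 : ∫ t in (0:ℝ)..(1/2), H (1 - t) = ∫ t in (1/2:ℝ)..1, H t := by
    rw [intervalIntegral.integral_comp_sub_left H 1]
    norm_num
  rw [e5] at b1
  rw [hmain, abs_mul, abs_of_pos hL]
  have tri : |X2 - X1| ≤ |X2| + |X1| := abs_sub X2 X1
  have fin : L * |X2 - X1| ≤ L * (|X2| + |X1|) := by gcongr
  have fin2 := mul_le_mul_of_nonneg_left (add_le_add b2 b1) hL.le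
  refine (fin.trans fin2).trans (le_of_eq ?_)
  ring
end

section
/- Let q > 1 and p > 1 satisfy 1/p + 1/q = 1, let f : I → ℝ be differentiable on the interior I° of an interval I ⊆ ℝ with a, b ∈ I, a < b, and f′ Lebesgue integrable, and let φ : [a,b] → [a,b] be continuous with φ(a) < φ(b). Suppose |f′|^q is strongly φ-convex with modulus c > 0 (i.e. strongly φ_h-convex with h(t) = t), and set G = c^q (φ(b) − φ(a))^{2q} B_{1/2}(q+1, q+1) − (c/12)(φ(b) − φ(a))², where B_{1/2}(q+1, q+1) = ∫_0^{1/2} t^q (1 − t)^q dt. If G > 0, then |(1/(φ(b) − φ(a))) ∫_{φ(a)}^{φ(b)} f(x) dx − f((φ(a) + φ(b))/2)| ≤ ((φ(b) − φ(a))/2) (1/(p+1))^{1/p} { ( (|f′(φ(a))|^q + 3|f′(φ(b))|^q)/8 + G )^{1/q} + ( (3|f′(φ(a))|^q + |f′(φ(b))|^q)/8 + G )^{1/q} }. -/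
open MeasureTheory Set intervalIntegral

lemma aux_left (p q : ℝ) (hp : 1 < p) (hq : 1 < q) (hpq : 1 / p + 1 / q = 1)
    (A d : ℝ) (hd : 0 < d) (f f' : ℝ → ℝ) (α β G : ℝ) (hα : 0 ≤ α) (hβ : 0 ≤ β) (hG : 0 < G)
    (hf : ∀ x ∈ Ioo A (A + d), HasDerivAt f (f' x) x)
    (hi : IntegrableOn f' (Ioo A (A + d)))
    (hb : ∀ x ∈ Ioo A (A + d), |f' x| ^ q ≤ (A + d - x) / d * α + (x - A) / d * β) :
    IntervalIntegrable f volume A (A + d / 2) ∧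
    |(∫ x in A..(A + d / 2), f x) - (d / 2) * f (A + d / 2)| ≤
      d ^ 2 / 2 * (1 / (p + 1)) ^ (1 / p) * ((3 * α + β) / 8 + G) ^ (1 / q) := by
  have hp0 : 0 < p := by linarith
  have hq0 : 0 < q := by linarith
  have hsub : Ioo A (A + d / 2) ⊆ Ioo A (A + d) := Ioo_subset_Ioo le_rfl (by linarith)
  have hlt : A < A + d / 2 := by linarith
  have hmm : A + d / 2 ∈ Ioo A (A + d) := ⟨by linarith, by linarith⟩
  set M : ℝ := (α + β) ^ (1 / q) with hM
  have hM0 : 0 ≤ M := by positivity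
  have hfM : ∀ x ∈ Ioo A (A + d), |f' x| ≤ M := by
    intro x hx
    have h1 : |f' x| ^ q ≤ α + β := by
      refine (hb x hx).trans ?_
      have h2 : (A + d - x) / d ≤ 1 := by rw [div_le_one hd]; linarith [hx.1]
      have h3 : (x - A) / d ≤ 1 := by rw [div_le_one hd]; linarith [hx.2]
      nlinarith
    rw [hM, one_div]
    exact (Real.le_rpow_inv_iff_of_pos (abs_nonneg _) (by positivity) hq0).2 h1
  have hfC : ∀ x ∈ Ioo A (A + d), |f x| ≤ |f (A + d / 2)| + M * d := by
    intro x hx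
    have h1 := Convex.norm_image_sub_le_of_norm_hasDerivWithin_le
      (f := f) (f' := f') (C := M)
      (fun y hy => (hf y hy).hasDerivWithinAt) (fun y hy => hfM y hy) (convex_Ioo A (A + d)) hmm hx
    rw [Real.norm_eq_abs, Real.norm_eq_abs] at h1
    have h2 : |x - (A + d / 2)| ≤ d := by
      rw [abs_le]; constructor <;> linarith [hx.1, hx.2]
    have h3 : |f x| ≤ |f (A + d / 2)| + |f x - f (A + d / 2)| := by
      have := abs_add_le (f (A + d / 2)) (f x - f (A + d / 2))
      simpa using this
    have h4 : M * |x - (A + d / 2)| ≤ M * d := by gcongr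
    linarith
  set C := |f (A + d / 2)| + M * d with hC
  have hcont : ContinuousOn f (Ioo A (A + d)) := fun x hx =>
    (hf x hx).continuousAt.continuousWithinAt
  have hfi : IntegrableOn f (Ioo A (A + d / 2)) := by
    refine IntegrableOn.of_bound (C := C) (by simp)
      ?_ ?_
    · exact (hcont.mono hsub).aestronglyMeasurable measurableSet_Ioo
    · exact (ae_restrict_mem measurableSet_Ioo).mono fun x hx => hfC x (hsub hx)
  have hfii : IntervalIntegrable f volume A (A + d / 2) := by
    rwa [intervalIntegrable_iff_integrableOn_Ioo_of_le hlt.le]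
  have hf'ii : IntervalIntegrable f' volume A (A + d / 2) := by
    rw [intervalIntegrable_iff_integrableOn_Ioo_of_le hlt.le]; exact hi.mono_set hsub
  refine ⟨hfii, ?_⟩
  have hgi : IntervalIntegrable (fun x => (x - A) * f' x) volume A (A + d / 2) :=
    hf'ii.continuousOn_mul (by fun_prop)
  have key := integral_eq_sub_of_hasDerivAt_of_tendsto (f := fun x => (x - A) * f x)
    (f' := fun x => f x + (x - A) * f' x) (fa := 0) (fb := (d / 2) * f (A + d / 2)) hlt
    (fun x hx => by
      have := ((hasDerivAt_id x).sub_const A).mul (hf x (hsub hx))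
      simpa using! this)
    (hfii.add hgi)
    (by
      have h1 : Filter.Tendsto (fun x => |x - A| * C) (nhdsWithin A (Ioi A)) (nhds 0) := by
        have : Continuous (fun x => |x - A| * C) := by fun_prop
        have h := this.tendsto A
        simp only [sub_self, abs_zero, zero_mul] at h
        exact h.mono_left nhdsWithin_le_nhds
      refine squeeze_zero_norm' ?_ h1
      filter_upwards [Ioo_mem_nhdsGT hlt] with x hx
      rw [norm_mul, Real.norm_eq_abs, Real.norm_eq_abs]
      exact mul_le_mul_of_nonneg_left (hfC x (hsub hx)) (abs_nonneg _))
    (by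
      have h1 : ContinuousAt (fun x => (x - A) * f x) (A + d / 2) :=
        (by fun_prop : ContinuousAt (fun x => x - A) (A + d / 2)).mul (hf _ hmm).continuousAt
      have h := h1.tendsto
      simp only [add_sub_cancel_left] at h
      exact h.mono_left nhdsWithin_le_nhds)
  rw [intervalIntegral.integral_add hfii hgi] at key
  have e1 : (∫ x in A..(A + d / 2), f x) - (d / 2) * f (A + d / 2)
      = -∫ x in A..(A + d / 2), (x - A) * f' x := by linarith
  rw [e1, abs_neg]
  have e2 : |∫ x in A..(A + d / 2), (x - A) * f' x|
      ≤ ∫ x in Ioc A (A + d / 2), (x - A) * |f' x| := by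
    rw [intervalIntegral.integral_of_le hlt.le]
    refine (MeasureTheory.abs_integral_le_integral_abs).trans (le_of_eq ?_)
    refine setIntegral_congr_fun measurableSet_Ioc fun x hx => ?_
    simp only [abs_mul]
    rw [abs_of_nonneg (by linarith [hx.1] : 0 ≤ x - A)]
  refine e2.trans ?_
  have hfm : AEStronglyMeasurable f' (volume.restrict (Ioc A (A + d / 2))) :=
    ((intervalIntegrable_iff_integrableOn_Ioc_of_le hlt.le).1 hf'ii).1
  have hsub' : Ioc A (A + d / 2) ⊆ Ioo A (A + d) := fun x hx => ⟨hx.1, by linarith [hx.2]⟩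
  have hH := integral_mul_le_Lp_mul_Lq_of_nonneg (μ := volume.restrict (Ioc A (A + d / 2)))
    (p := p) (q := q)
    (Real.holderConjugate_iff.2 ⟨hp, by simpa using hpq⟩) (f := fun x => x - A)
    (g := fun x => |f' x|)
    ((ae_restrict_mem measurableSet_Ioc).mono fun x hx => by
      simp only [Pi.zero_apply]; linarith [hx.1])
    (Filter.Eventually.of_forall fun x => abs_nonneg _)
    (MemLp.of_bound (C := d) (by fun_prop)
      ((ae_restrict_mem measurableSet_Ioc).mono fun x hx => by
        rw [Real.norm_eq_abs, abs_le]; constructor <;> linarith [hx.1, hx.2]))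
    (MemLp.of_bound (C := M) (by simpa using hfm.norm)
      ((ae_restrict_mem measurableSet_Ioc).mono fun x hx => by
        rw [Real.norm_eq_abs, abs_abs]; exact hfM x (hsub' hx)))
  refine hH.trans ?_
  have i1 : ∫ x in Ioc A (A + d / 2), (x - A) ^ p = (d / 2) ^ (p + 1) / (p + 1) := by
    rw [← intervalIntegral.integral_of_le hlt.le,
      intervalIntegral.integral_comp_sub_right (fun x => x ^ p) A,
      integral_rpow (Or.inl (by linarith))]
    rw [sub_self, add_sub_cancel_left, Real.zero_rpow (by linarith), sub_zero]
  have i2 : ∫ x in Ioc A (A + d / 2), |f' x| ^ q ≤ d * ((3 * α + β) / 8 + G) := by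
    have h1 : ∫ x in Ioc A (A + d / 2), |f' x| ^ q ≤
        ∫ x in Ioc A (A + d / 2), ((A + d - x) / d * α + (x - A) / d * β) := by
      refine integral_mono_of_nonneg (Filter.Eventually.of_forall fun x => by
        simp only [Pi.zero_apply]; positivity) ?_
        ((ae_restrict_mem measurableSet_Ioc).mono fun x hx => hb x (hsub' hx))
      have : Continuous (fun x : ℝ => (A + d - x) / d * α + (x - A) / d * β) := by fun_prop
      exact this.integrableOn_Ioc
    refine h1.trans ?_
    rw [← intervalIntegral.integral_of_le hlt.le]
    have h2 : ∫ x in A..(A + d / 2), ((A + d - x) / d * α + (x - A) / d * β)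
        = d * ((3 * α + β) / 8) := by
      have hF : ∀ x : ℝ, HasDerivAt
          (fun x => -(A + d - x) ^ 2 / (2 * d) * α + (x - A) ^ 2 / (2 * d) * β)
          ((A + d - x) / d * α + (x - A) / d * β) x := by
        intro x
        have h3 := (((((hasDerivAt_id x).const_sub (A + d)).pow 2).neg.div_const (2 * d)).mul_const
          α).add (((((hasDerivAt_id x).sub_const A).pow 2).div_const (2 * d)).mul_const β)
        refine HasDerivAt.congr_deriv h3 ?_
        simp only [id]
        norm_num
        field_simp
      rw [intervalIntegral.integral_eq_sub_of_hasDerivAt (fun x _ => hF x)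
        (Continuous.intervalIntegrable (by fun_prop) _ _)]
      field_simp
      ring
    rw [h2]
    nlinarith
  set S := (3 * α + β) / 8 + G with hS
  have hS0 : 0 < S := by positivity
  rw [i1]
  have i3 : (∫ x in Ioc A (A + d / 2), |f' x| ^ q) ^ (1 / q) ≤ d ^ (1 / q) * S ^ (1 / q) := by
    rw [← Real.mul_rpow hd.le hS0.le]
    exact Real.rpow_le_rpow (integral_nonneg fun x => by positivity) i2 (by positivity)
  have i4 : ((d / 2) ^ (p + 1) / (p + 1)) ^ (1 / p)
      ≤ (d / 2) * d ^ (1 / p) * (1 / (p + 1)) ^ (1 / p) := by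
    rw [div_eq_mul_one_div, Real.mul_rpow (by positivity) (by positivity),
      ← Real.rpow_mul (by positivity)]
    have : (p + 1) * (1 / p) = 1 + 1 / p := by field_simp
    rw [this, Real.rpow_add (by positivity), Real.rpow_one]
    gcongr
    linarith
  have i5 : d ^ (1 / p) * d ^ (1 / q) = d := by
    rw [← Real.rpow_add hd, hpq, Real.rpow_one]
  calc _ ≤ ((d / 2) * d ^ (1 / p) * (1 / (p + 1)) ^ (1 / p)) * (d ^ (1 / q) * S ^ (1 / q)) := by
        gcongr
    _ = (d / 2) * (d ^ (1 / p) * d ^ (1 / q)) * (1 / (p + 1)) ^ (1 / p) * S ^ (1 / q) := by ring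
    _ = _ := by rw [i5]; ring

theorem stmt15 (p q : ℝ) (hp : 1 < p) (hq : 1 < q) (hpq : 1 / p + 1 / q = 1)
    (I : Set ℝ) (hI : Convex ℝ I) (a b : ℝ) (ha : a ∈ I) (hb : b ∈ I)
    (hab : a < b) (f f' φ : ℝ → ℝ)
    (hf : ∀ x ∈ interior I, HasDerivAt f (f' x) x)
    (hf'int : MeasureTheory.IntegrableOn f' (Set.Icc a b))
    (hφmap : ∀ x ∈ Set.Icc a b, φ x ∈ Set.Icc a b)
    (hφcont : ContinuousOn φ (Set.Icc a b))
    (hφab : φ a < φ b)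
    (c : ℝ) (hc : 0 < c)
    (hconv : StronglyPhiHConvexOn a b φ (fun t => t) c (fun x => |f' x| ^ q))
    (G : ℝ)
    (hG : G = c ^ q * (φ b - φ a) ^ (2 * q) *
        (∫ t in (0:ℝ)..(1/2), t ^ q * (1 - t) ^ q) - (c / 12) * (φ b - φ a) ^ 2)
    (hGpos : 0 < G) :
    |(1 / (φ b - φ a)) * (∫ x in φ a..φ b, f x) - f ((φ a + φ b) / 2)| ≤
      ((φ b - φ a) / 2) * (1 / (p + 1)) ^ (1 / p) *
        (((|f' (φ a)| ^ q + 3 * |f' (φ b)| ^ q) / 8 + G) ^ (1 / q) +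
          ((3 * |f' (φ a)| ^ q + |f' (φ b)| ^ q) / 8 + G) ^ (1 / q)) := by
  clear hG
  set A := φ a with hA
  set B := φ b with hB
  have hAm := hφmap a ⟨le_rfl, hab.le⟩
  have hBm := hφmap b ⟨hab.le, le_rfl⟩
  set d := B - A with hd
  have hd0 : 0 < d := by linarith
  have hsub : Ioo A B ⊆ Ioo a b := Ioo_subset_Ioo hAm.1 hBm.2
  have hint : Ioo a b ⊆ interior I := by
    refine interior_maximal ?_ isOpen_Ioo
    exact Ioo_subset_Icc_self.trans (hI.ordConnected.out ha hb)
  have hf1 : ∀ x ∈ Ioo A B, HasDerivAt f (f' x) x := fun x hx => hf x (hint (hsub hx))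
  have hi1 : IntegrableOn f' (Ioo A B) := hf'int.mono_set (hsub.trans Ioo_subset_Icc_self)
  have hb1 : ∀ x ∈ Ioo A B,
      |f' x| ^ q ≤ (B - x) / d * |f' A| ^ q + (x - A) / d * |f' B| ^ q := by
    intro x hx
    have h := hconv a ⟨le_rfl, hab.le⟩ b ⟨hab.le, le_rfl⟩ ((B - x) / d)
      ⟨div_pos (by linarith [hx.2]) hd0, by rw [div_lt_one hd0]; linarith [hx.1]⟩
    simp only [← hA, ← hB] at h
    have e1 : 1 - (B - x) / d = (x - A) / d := by field_simp; rw [hd]; ring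
    have e2 : (B - x) / d * A + (x - A) / d * B = x := by field_simp; rw [hd]; ring
    rw [e1, e2] at h
    have h0 : 0 ≤ c * ((B - x) / d) * ((x - A) / d) * (A - B) ^ 2 := by
      have := hx.1
      have := hx.2
      have : 0 ≤ B - x := by linarith
      have : 0 ≤ x - A := by linarith
      positivity
    linarith
  have hBA : B = A + d := by rw [hd]; ring
  obtain ⟨hl1, hl2⟩ := aux_left p q hp hq hpq A d hd0 f f' (|f' A| ^ q) (|f' B| ^ q) G
    (by positivity) (by positivity) hGpos (by rwa [← hBA]) (by rwa [← hBA]) (by rwa [← hBA])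
  obtain ⟨hr1, hr2⟩ := aux_left p q hp hq hpq (-B) d hd0 (fun x => f (-x)) (fun x => -f' (-x))
    (|f' B| ^ q) (|f' A| ^ q) G (by positivity) (by positivity) hGpos
    (fun x hx => by
      have h := hf1 (-x) ⟨by linarith [hx.2], by linarith [hx.1]⟩
      simpa using! h.scomp x (hasDerivAt_neg x))
    (by
      have h : IntervalIntegrable f' volume B A := by
        refine IntervalIntegrable.symm ?_
        rwa [intervalIntegrable_iff_integrableOn_Ioo_of_le hφab.le]
      have h2 : IntervalIntegrable (fun x => f' (-x)) volume (-B) (-A) := by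
        simpa using (IntervalIntegrable.iff_comp_neg (f := f')).1 h
      rw [intervalIntegrable_iff_integrableOn_Ioo_of_le (by linarith)] at h2
      have e : -B + d = -A := by rw [hd]; ring
      rw [e]
      exact h2.neg)
    (fun x hx => by
      have h := hb1 (-x) ⟨by linarith [hx.2], by linarith [hx.1]⟩
      rw [abs_neg]
      refine h.trans (le_of_eq ?_)
      rw [hd]; ring)
  have hm1 : A + d / 2 = (A + B) / 2 := by rw [hd]; ring
  have hm2 : -B + d / 2 = -((A + B) / 2) := by rw [hd]; ring
  rw [hm1] at hl1 hl2
  rw [hm2] at hr1 hr2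
  rw [intervalIntegral.integral_comp_neg (fun x => f x)] at hr2
  simp only [neg_neg] at hr2
  have hr3 : IntervalIntegrable f volume ((A + B) / 2) B := by
    have := (IntervalIntegrable.iff_comp_neg (f := f) (a := B) (b := (A + B) / 2)).2 hr1
    exact this.symm
  have hsum := intervalIntegral.integral_add_adjacent_intervals hl1 hr3
  rw [← hsum]
  set J1 := ∫ x in A..((A + B) / 2), f x
  set J2 := ∫ x in ((A + B) / 2)..B, f x
  set y := f ((A + B) / 2)
  have e : 1 / d * (J1 + J2) - y = 1 / d * ((J1 - d / 2 * y) + (J2 - d / 2 * y)) := by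
    field_simp; ring
  rw [e, abs_mul, abs_of_pos (by positivity : 0 < 1 / d)]
  have h3 := (abs_add_le (J1 - d / 2 * y) (J2 - d / 2 * y)).trans (add_le_add hl2 hr2)
  refine (mul_le_mul_of_nonneg_left h3 (by positivity)).trans (le_of_eq ?_)
  rw [add_comm (3 * |f' B| ^ q)]
  field_simp
  ring
end

section
/- Let s ∈ (0,1), let q > 1 and p > 1 satisfy 1/p + 1/q = 1, let f : I → ℝ be differentiable on the interior I° of an interval I ⊆ ℝ with a, b ∈ I, a < b, and f′ Lebesgue integrable, and let φ : [a,b] → [a,b] be continuous with φ(a) < φ(b). Suppose |f′|^q is strongly φ_s-convex with modulus c > 0 (i.e. strongly φ_h-convex with h(t) = t^s), and set G = c^q (φ(b) − φ(a))^{2q} B_{1/2}(q+1, q+1) − (c/12)(φ(b) − φ(a))², where B_{1/2}(q+1, q+1) = ∫_0^{1/2} t^q (1 − t)^q dt. If G > 0, then |(1/(φ(b) − φ(a))) ∫_{φ(a)}^{φ(b)} f(x) dx − f((φ(a) + φ(b))/2)| ≤ ((φ(b) − φ(a))/2) (1/(p+1))^{1/p} { ( (1/(2^{s+1}(s+1)))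 |f′(φ(a))|^q + ((1 − 2^{−(s+1)})/(s+1)) |f′(φ(b))|^q + G )^{1/q} + ( ((1 − 2^{−(s+1)})/(s+1)) |f′(φ(a))|^q + (1/(2^{s+1}(s+1))) |f′(φ(b))|^q + G )^{1/q} }. -/
open MeasureTheory Set intervalIntegral

lemma half_bound (s p q : ℝ) (hs : 0 < s) (hp : 1 < p) (hq : 1 < q) (hpq : 1 / p + 1 / q = 1)
    (w : ℝ → ℝ) (α β X : ℝ) (hα : 0 ≤ α) (hβ : 0 ≤ β)
    (hw : IntervalIntegrable w volume 0 (1/2))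
    (hb : ∀ t ∈ Ioc (0:ℝ) (1/2), |w t| ^ q ≤ t ^ s * α + (1 - t) ^ s * β)
    (hX : 1 / ((2:ℝ) ^ (s + 1) * (s + 1)) * α + (1 - (2:ℝ) ^ (-(s + 1))) / (s + 1) * β ≤ X) :
    ∫ t in (0:ℝ)..(1/2), t * |w t| ≤ 1 / 2 * (1 / (p + 1)) ^ (1 / p) * X ^ (1 / q) := by
  have h0 : (0:ℝ) ≤ 1/2 := by norm_num
  have hc : p.HolderConjugate q := by
    rw [Real.holderConjugate_iff]
    exact ⟨hp, by simpa [one_div] using hpq⟩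
  have hq0 : 0 < q := by linarith
  have hp0 : 0 < p := by linarith
  have hwm : AEStronglyMeasurable w (volume.restrict (Ioc (0:ℝ) (1/2))) :=
    ((intervalIntegrable_iff_integrableOn_Ioc_of_le h0).1 hw).aestronglyMeasurable
  have hwa : ∀ t ∈ Ioc (0:ℝ) (1/2), |w t| ≤ (α + β) ^ (1/q) := by
    intro t ht
    have h1 := hb t ht
    have h2 : t ^ s ≤ 1 := Real.rpow_le_one ht.1.le (by linarith [ht.2]) hs.le
    have h3 : (1 - t) ^ s ≤ 1 := Real.rpow_le_one (by linarith [ht.2]) (by linarith [ht.1]) hs.le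
    have h4 : |w t| ^ q ≤ α + β := by nlinarith
    calc |w t| = (|w t| ^ q) ^ (1/q) := by
          rw [← Real.rpow_mul (abs_nonneg _), mul_one_div_cancel hq0.ne', Real.rpow_one]
      _ ≤ _ := Real.rpow_le_rpow (by positivity) h4 (by positivity)
  have hm1 : MemLp (fun t : ℝ => t) (ENNReal.ofReal p) (volume.restrict (Ioc (0:ℝ) (1/2))) := by
    refine MemLp.of_bound (measurable_id.aestronglyMeasurable) (1/2) ?_
    refine (ae_restrict_iff' measurableSet_Ioc).2 (Filter.Eventually.of_forall fun t ht => ?_)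
    rw [Real.norm_eq_abs, abs_of_pos ht.1]; exact ht.2
  have hm2 : MemLp (fun t : ℝ => |w t|) (ENNReal.ofReal q) (volume.restrict (Ioc (0:ℝ) (1/2))) := by
    refine MemLp.of_bound (by simpa using hwm.norm) ((α + β) ^ (1/q)) ?_
    refine (ae_restrict_iff' measurableSet_Ioc).2 (Filter.Eventually.of_forall fun t ht => ?_)
    rw [Real.norm_eq_abs, abs_abs]; exact hwa t ht
  have hH := integral_mul_le_Lp_mul_Lq_of_nonneg hc
    (μ := volume.restrict (Ioc (0:ℝ) (1/2))) (f := fun t : ℝ => t) (g := fun t => |w t|)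
    ((ae_restrict_iff' measurableSet_Ioc).2 (Filter.Eventually.of_forall fun t ht => ht.1.le))
    (Filter.Eventually.of_forall fun t => abs_nonneg _) hm1 hm2
  rw [← intervalIntegral.integral_of_le h0, ← intervalIntegral.integral_of_le h0,
    ← intervalIntegral.integral_of_le h0] at hH
  have hI1 : (∫ t in (0:ℝ)..(1/2), t ^ p) ^ (1/p) ≤ 1 / 2 * (1 / (p + 1)) ^ (1 / p) := by
    rw [integral_rpow (Or.inl (by linarith)), Real.zero_rpow (by linarith), sub_zero]
    have e : (1/2:ℝ) ^ (p+1) / (p+1) ≤ (1/2) ^ p * (1 / (p+1)) := by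
      rw [Real.rpow_add (by norm_num), Real.rpow_one, div_eq_mul_one_div]
      have : 0 ≤ (1/2:ℝ)^p := by positivity
      have h2 : 0 ≤ 1 / (p+1) := by positivity
      nlinarith [mul_nonneg this h2]
    calc _ ≤ ((1/2:ℝ) ^ p * (1 / (p+1))) ^ (1/p) :=
          Real.rpow_le_rpow (by positivity) e (by positivity)
      _ = _ := by
          rw [Real.mul_rpow (by positivity) (by positivity), ← Real.rpow_mul (by norm_num),
            mul_one_div_cancel hp0.ne', Real.rpow_one]
  have hpow1 : IntervalIntegrable (fun t : ℝ => t ^ s) volume 0 (1/2) :=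
    (Real.continuous_rpow_const hs.le).intervalIntegrable _ _
  have hpow2 : IntervalIntegrable (fun t : ℝ => (1 - t) ^ s) volume 0 (1/2) :=
    ((Real.continuous_rpow_const hs.le).comp (continuous_const.sub continuous_id)).intervalIntegrable _ _
  have hqi : IntervalIntegrable (fun t => |w t| ^ q) volume 0 (1/2) := by
    rw [intervalIntegrable_iff_integrableOn_Ioc_of_le h0]
    have := hm2.integrable_norm_rpow (by simpa using hq0) (by simp)
    simpa [IntegrableOn, ENNReal.toReal_ofReal hq0.le] using this
  have hI2 : (∫ t in (0:ℝ)..(1/2), |w t| ^ q) ≤ X := by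
    refine le_trans ?_ hX
    calc (∫ t in (0:ℝ)..(1/2), |w t| ^ q)
        ≤ ∫ t in (0:ℝ)..(1/2), (t ^ s * α + (1 - t) ^ s * β) := by
          rw [intervalIntegral.integral_of_le h0, intervalIntegral.integral_of_le h0]
          refine setIntegral_mono_on ((intervalIntegrable_iff_integrableOn_Ioc_of_le h0).1 hqi)
            ((intervalIntegrable_iff_integrableOn_Ioc_of_le h0).1
              ((hpow1.mul_const _).add (hpow2.mul_const _))) measurableSet_Ioc hb
      _ = _ := by
          rw [intervalIntegral.integral_add (hpow1.mul_const _) (hpow2.mul_const _),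
            intervalIntegral.integral_mul_const, intervalIntegral.integral_mul_const,
            intervalIntegral.integral_comp_sub_left (fun t : ℝ => t ^ s) 1,
            integral_rpow (Or.inl (by linarith)), integral_rpow (Or.inl (by linarith)),
            Real.zero_rpow (by linarith), Real.rpow_neg (by norm_num), sub_zero, sub_zero,
            Real.one_rpow, show (1:ℝ) - 1/2 = 2⁻¹ by norm_num, show (1/2:ℝ) = 2⁻¹ by norm_num,
            Real.inv_rpow (by norm_num)]
          field_simp
  have hI2' : 0 ≤ ∫ t in (0:ℝ)..(1/2), |w t| ^ q :=
    intervalIntegral.integral_nonneg h0 fun t _ => by positivity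
  refine hH.trans ?_
  exact mul_le_mul hI1 (Real.rpow_le_rpow hI2' hI2 (by positivity)) (by positivity) (by positivity)

lemma mid_identity (u u' : ℝ → ℝ) (hu : ∀ t ∈ Ioo (0:ℝ) 1, HasDerivAt u (u' t) t)
    (hi : IntervalIntegrable u' volume 0 1) :
    |(∫ t in (0:ℝ)..1, u t) - u (1/2)| ≤
      (∫ t in (0:ℝ)..(1/2), t * |u' t|) + ∫ t in (0:ℝ)..(1/2), t * |u' (1 - t)| := by
  have hsub : ∀ x ∈ Icc (0:ℝ) 1, ∀ y ∈ Icc (0:ℝ) 1, IntervalIntegrable u' volume x y := by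
    intro x hx y hy
    refine hi.mono_set ?_
    rw [uIcc_of_le zero_le_one]
    exact uIcc_subset_Icc hx hy
  set F : ℝ → ℝ := fun x => u (1/2) + ∫ t in (1/2:ℝ)..x, u' t with hF
  have hFu : ∀ x ∈ Ioo (0:ℝ) 1, F x = u x := by
    intro x hx
    have hh : (1/2:ℝ) ∈ Ioo (0:ℝ) 1 := by constructor <;> norm_num
    have := intervalIntegral.integral_eq_sub_of_hasDerivAt (a := 1/2) (b := x) (f := u) (f' := u')
      (fun y hy => hu y ((ordConnected_Ioo (a := (0:ℝ)) (b := 1)).uIcc_subset hh hx hy))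
      (hsub _ (Ioo_subset_Icc_self hh) _ (Ioo_subset_Icc_self hx))
    simp only [hF, this]; ring
  have hFd : ∀ x ∈ Ioo (0:ℝ) 1, HasDerivAt F (u' x) x := by
    intro x hx
    refine (hu x hx).congr_of_eventuallyEq ?_
    filter_upwards [Ioo_mem_nhds hx.1 hx.2] with y hy using hFu y hy
  have hFc : ContinuousOn F (Icc 0 1) := by
    refine continuousOn_const.add ?_
    have := intervalIntegral.continuousOn_primitive_interval' (μ := volume) (f := u') (a := 1/2)
      (b₁ := 0) (b₂ := 1) hi (by rw [uIcc_of_le zero_le_one]; constructor <;> norm_num)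
    rwa [uIcc_of_le zero_le_one] at this
  have hint : (∫ t in (0:ℝ)..1, u t) = ∫ t in (0:ℝ)..1, F t := by
    rw [intervalIntegral.integral_of_le zero_le_one, intervalIntegral.integral_of_le zero_le_one,
      integral_Ioc_eq_integral_Ioo, integral_Ioc_eq_integral_Ioo]
    exact setIntegral_congr_fun measurableSet_Ioo fun x hx => (hFu x hx).symm
  have hFm : F (1/2) = u (1/2) := by simp [hF]
  have i1 : IntervalIntegrable u' volume 0 (1/2) := hsub _ (by norm_num) _ (by norm_num)
  have i2 : IntervalIntegrable u' volume (1/2) 1 := hsub _ (by norm_num) _ (by norm_num)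
  have hFi : ∀ x ∈ Icc (0:ℝ) 1, ∀ y ∈ Icc (0:ℝ) 1, IntervalIntegrable F volume x y :=
    fun x hx y hy => (hFc.mono (uIcc_subset_Icc hx hy)).intervalIntegrable
  have P1 := intervalIntegral.integral_mul_deriv_eq_deriv_mul_of_hasDerivAt
    (a := 0) (b := 1/2) (u := fun t => t) (v := F) (u' := fun _ => 1) (v' := u')
    continuousOn_id (hFc.mono (uIcc_subset_Icc (by norm_num) (by norm_num)))
    (fun x _ => hasDerivAt_id x)
    (fun x hx => hFd x (by norm_num at hx; exact ⟨hx.1, by linarith [hx.2]⟩))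
    (by simp) i1
  have P2 := intervalIntegral.integral_mul_deriv_eq_deriv_mul_of_hasDerivAt
    (a := 1/2) (b := 1) (u := fun t => t - 1) (v := F) (u' := fun _ => 1) (v' := u')
    (by fun_prop) (hFc.mono (uIcc_subset_Icc (by norm_num) (by norm_num)))
    (fun x _ => (hasDerivAt_id x).sub_const 1)
    (fun x hx => hFd x (by norm_num at hx; exact ⟨by linarith [hx.1], hx.2⟩))
    (by simp) i2
  have hadd := intervalIntegral.integral_add_adjacent_intervals
    (hFi 0 (by norm_num) (1/2) (by norm_num)) (hFi (1/2) (by norm_num) 1 (by norm_num))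
  simp only [one_mul] at P1 P2
  have key : (∫ t in (0:ℝ)..1, u t) - u (1/2) =
      -((∫ t in (0:ℝ)..(1/2), t * u' t) + ∫ t in (1/2:ℝ)..1, (t - 1) * u' t) := by
    rw [P1, P2, hint, ← hadd, ← hFm]; ring
  rw [key, abs_neg]
  refine (abs_add_le _ _).trans (add_le_add ?_ ?_)
  · refine (intervalIntegral.abs_integral_le_integral_abs (by norm_num)).trans (le_of_eq ?_)
    refine intervalIntegral.integral_congr fun t ht => ?_
    rw [uIcc_of_le (by norm_num)] at ht
    simp only [abs_mul, abs_of_nonneg ht.1]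
  · refine (intervalIntegral.abs_integral_le_integral_abs (by norm_num)).trans (le_of_eq ?_)
    have := intervalIntegral.integral_comp_sub_left (a := 0) (b := 1/2)
      (fun t : ℝ => |(t - 1) * u' t|) 1
    norm_num at this
    norm_num
    rw [← this]
    refine intervalIntegral.integral_congr fun t ht => ?_
    rw [uIcc_of_le (by norm_num)] at ht
    simp only [abs_mul, abs_of_nonneg ht.1]

theorem stmt16 (s : ℝ) (hs : s ∈ Set.Ioo (0:ℝ) 1)
    (p q : ℝ) (hp : 1 < p) (hq : 1 < q) (hpq : 1 / p + 1 / q = 1)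
    (I : Set ℝ) (hI : Convex ℝ I) (a b : ℝ) (ha : a ∈ I) (hb : b ∈ I)
    (hab : a < b) (f f' φ : ℝ → ℝ)
    (hf : ∀ x ∈ interior I, HasDerivAt f (f' x) x)
    (hf'int : MeasureTheory.IntegrableOn f' (Set.Icc a b))
    (hφmap : ∀ x ∈ Set.Icc a b, φ x ∈ Set.Icc a b)
    (hφcont : ContinuousOn φ (Set.Icc a b))
    (hφab : φ a < φ b)
    (c : ℝ) (hc : 0 < c)
    (hconv : StronglyPhiHConvexOn a b φ (fun t => t ^ s) c (fun x => |f' x| ^ q))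
    (G : ℝ)
    (hG : G = c ^ q * (φ b - φ a) ^ (2 * q) *
        (∫ t in (0:ℝ)..(1/2), t ^ q * (1 - t) ^ q) - (c / 12) * (φ b - φ a) ^ 2)
    (hGpos : 0 < G) :
    |(1 / (φ b - φ a)) * (∫ x in φ a..φ b, f x) - f ((φ a + φ b) / 2)| ≤
      ((φ b - φ a) / 2) * (1 / (p + 1)) ^ (1 / p) *
        ((1 / ((2:ℝ) ^ (s + 1) * (s + 1)) * |f' (φ a)| ^ q +
            (1 - (2:ℝ) ^ (-(s + 1))) / (s + 1) * |f' (φ b)| ^ q + G) ^ (1 / q) +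
          ((1 - (2:ℝ) ^ (-(s + 1))) / (s + 1) * |f' (φ a)| ^ q +
            1 / ((2:ℝ) ^ (s + 1) * (s + 1)) * |f' (φ b)| ^ q + G) ^ (1 / q)) := by

  obtain ⟨hs0, hs1⟩ := hs
  have haI : a ∈ Icc a b := left_mem_Icc.2 hab.le
  have hbI : b ∈ Icc a b := right_mem_Icc.2 hab.le
  have hA := hφmap a haI
  have hB := hφmap b hbI
  have hint : Ioo a b ⊆ interior I := by
    refine interior_maximal ?_ isOpen_Ioo
    exact Ioo_subset_Icc_self.trans (hI.ordConnected.out ha hb)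
  have hcv := fun t ht => hconv a haI b hbI t ht
  simp only at hcv
  generalize φ a = A at *
  generalize φ b = B at *
  have hD : 0 < B - A := by linarith
  have hline : ∀ t : ℝ, t * A + (1 - t) * B = B - (B - A) * t := fun t => by ring
  have hw : IntervalIntegrable (fun t => f' (B - (B - A) * t)) volume 0 1 := by
    have h1 : IntervalIntegrable f' volume B A := by
      rw [intervalIntegrable_iff']
      exact hf'int.mono_set (uIcc_subset_Icc hB hA)
    have h2 := (h1.comp_sub_left B).comp_mul_left (c := B - A)
    simpa [div_self hD.ne'] using h2
  have hcv' : ∀ t ∈ Ioo (0:ℝ) 1, |f' (B - (B - A) * t)| ^ q ≤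
      t ^ s * |f' A| ^ q + (1 - t) ^ s * |f' B| ^ q := by
    intro t ht
    have := hcv t ht
    rw [hline] at this
    have h2 : 0 ≤ c * t * (1 - t) * (A - B) ^ 2 :=
      mul_nonneg (mul_nonneg (mul_nonneg hc.le ht.1.le) (by linarith [ht.2])) (sq_nonneg _)
    linarith
  have hM := mid_identity (fun t => f (B - (B - A) * t))
    (fun t => -(B - A) * f' (B - (B - A) * t)) (by
      intro t ht
      have hx : B - (B - A) * t ∈ Ioo a b := by
        have h1 := mul_pos hD ht.1
        have h2 := mul_pos hD (sub_pos.2 ht.2)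
        constructor
        · nlinarith [hA.1]
        · nlinarith [hB.2]
      have h1 : HasDerivAt (fun t => B - (B - A) * t) (-(B - A)) t := by
        simpa using ((hasDerivAt_id t).const_mul (B - A)).const_sub B
      have := (hf _ (hint hx)).comp t h1
      simpa [Function.comp_def, mul_comm] using this) (hw.const_mul _)
  have hL : (∫ t in (0:ℝ)..1, f (B - (B - A) * t)) = 1 / (B - A) * ∫ x in A..B, f x := by
    rw [intervalIntegral.integral_comp_sub_mul f hD.ne']
    simp
  have hmid : B - (B - A) * (1/2) = (A + B) / 2 := by ring
  simp only [hL, hmid, abs_mul, abs_neg, abs_of_pos hD] at hM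
  have e1 : ∀ w : ℝ → ℝ, (∫ t in (0:ℝ)..(1/2), t * ((B - A) * |w t|)) =
      (B - A) * ∫ t in (0:ℝ)..(1/2), t * |w t| := by
    intro w
    rw [← intervalIntegral.integral_const_mul]
    congr 1; ext t; ring
  rw [e1 (fun t => f' (B - (B - A) * t)), e1 (fun t => f' (B - (B - A) * (1 - t)))] at hM
  have H1 := half_bound s p q hs0 hp hq hpq (fun t => f' (B - (B - A) * t)) (|f' A| ^ q) (|f' B| ^ q)
    (1 / ((2:ℝ) ^ (s + 1) * (s + 1)) * |f' A| ^ q +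
            (1 - (2:ℝ) ^ (-(s + 1))) / (s + 1) * |f' B| ^ q + G) (by positivity) (by positivity)
    (hw.mono_set (by
      rw [uIcc_of_le zero_le_one]; exact uIcc_subset_Icc (by norm_num) (by norm_num)))
    (fun t ht => hcv' t ⟨ht.1, by linarith [ht.2]⟩) (by linarith)
  have H2 := half_bound s p q hs0 hp hq hpq (fun t => f' (B - (B - A) * (1 - t)))
    (|f' B| ^ q) (|f' A| ^ q)
    ((1 - (2:ℝ) ^ (-(s + 1))) / (s + 1) * |f' A| ^ q +
            1 / ((2:ℝ) ^ (s + 1) * (s + 1)) * |f' B| ^ q + G) (by positivity) (by positivity)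
    (by
      have h2 := (hw.comp_sub_left 1).symm
      norm_num at h2
      exact h2.mono_set (by
        rw [uIcc_of_le zero_le_one]; exact uIcc_subset_Icc (by norm_num) (by norm_num)))
    (fun t ht => by
      have := hcv' (1 - t) ⟨by linarith [ht.2], by linarith [ht.1]⟩
      rw [sub_sub_cancel] at this
      linarith) (by linarith)
  refine hM.trans ?_
  calc _ ≤ _ := add_le_add (mul_le_mul_of_nonneg_left H1 hD.le) (mul_le_mul_of_nonneg_left H2 hD.le)
    _ = _ := by ring
end

section
/- Let q > 1 and p > 1 satisfy 1/p + 1/q = 1, let f : I → ℝ be differentiable on the interior I° of an interval I ⊆ ℝ with a, b ∈ I, a < b, and f′ Lebesgue integrable, and let φ : [a,b] → [a,b] be continuous with φ(a) < φ(b). Suppose |f′|^q is a strongly φ-P-function with modulus c > 0 (i.e. strongly φ_h-convex with h(t) = 1), and set G = c^q (φ(b) − φ(a))^{2q} B_{1/2}(q+1, q+1) − (c/12)(φ(b) − φ(a))², where B_{1/2}(q+1, q+1) = ∫_0^{1/2} t^q (1 − t)^q dt. If G > 0, then |(1/(φ(b) − φ(a))) ∫_{φ(a)}^{φ(b)} f(x)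 dx − f((φ(a) + φ(b))/2)| ≤ (φ(b) − φ(a)) (1/(p+1))^{1/p} ( (|f′(φ(a))|^q + |f′(φ(b))|^q)/2 + G )^{1/q}. -/
open MeasureTheory Set intervalIntegral

theorem stmt17 (p q : ℝ) (hp : 1 < p) (hq : 1 < q) (hpq : 1 / p + 1 / q = 1)
    (I : Set ℝ) (hI : Convex ℝ I) (a b : ℝ) (ha : a ∈ I) (hb : b ∈ I)
    (hab : a < b) (f f' φ : ℝ → ℝ)
    (hf : ∀ x ∈ interior I, HasDerivAt f (f' x) x)
    (hf'int : MeasureTheory.IntegrableOn f' (Set.Icc a b))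
    (hφmap : ∀ x ∈ Set.Icc a b, φ x ∈ Set.Icc a b)
    (hφcont : ContinuousOn φ (Set.Icc a b))
    (hφab : φ a < φ b)
    (c : ℝ) (hc : 0 < c)
    (hconv : StronglyPhiHConvexOn a b φ (fun _ => 1) c (fun x => |f' x| ^ q))
    (G : ℝ)
    (hG : G = c ^ q * (φ b - φ a) ^ (2 * q) *
        (∫ t in (0:ℝ)..(1/2), t ^ q * (1 - t) ^ q) - (c / 12) * (φ b - φ a) ^ 2)
    (hGpos : 0 < G) :
    |(1 / (φ b - φ a)) * (∫ x in φ a..φ b, f x) - f ((φ a + φ b) / 2)| ≤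
      (φ b - φ a) * (1 / (p + 1)) ^ (1 / p) *
        ((|f' (φ a)| ^ q + |f' (φ b)| ^ q) / 2 + G) ^ (1 / q) := by
  have hp0 : 0 < p := by linarith
  have hq0 : 0 < q := by linarith
  have haI : a ∈ Icc a b := ⟨le_rfl, hab.le⟩
  have hbI : b ∈ Icc a b := ⟨hab.le, le_rfl⟩
  have hα := hφmap a haI
  have hβ := hφmap b hbI
  have hc1 := hconv b hbI a haI
  clear hconv hG hφmap hφcont hf'int
  generalize φ a = α at *
  generalize φ b = β at *
  set M := |f' α| ^ q + |f' β| ^ q with hM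
  have hM0 : 0 ≤ M := by positivity
  set K := M ^ (1 / q) with hK
  have hK0 : 0 ≤ K := by positivity
  have hL : 0 < β - α := by linarith
  -- pointwise bound on the derivative
  have hbd : ∀ x ∈ Ioo α β, |f' x| ≤ K := by
    intro x hx
    have ht : (x - α) / (β - α) ∈ Ioo (0:ℝ) 1 := by
      constructor
      · exact div_pos (by linarith [hx.1]) hL
      · rw [div_lt_one hL]; linarith [hx.2]
    have h1 := hc1 _ ht
    have hx' : (x - α) / (β - α) * β + (1 - (x - α) / (β - α)) * α = x := by
      field_simp; ring
    simp only [hx'] at h1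
    have h2 : 0 ≤ c * ((x - α) / (β - α)) * (1 - (x - α) / (β - α)) * (β - α) ^ 2 := by
      have := ht.1
      have h3 : 0 ≤ 1 - (x - α) / (β - α) := by linarith [ht.2]
      positivity
    have h3 : |f' x| ^ q ≤ M := by rw [hM]; linarith
    have h4 := Real.rpow_le_rpow (by positivity) h3 (by positivity : 0 ≤ 1 / q)
    rwa [← Real.rpow_mul (abs_nonneg _), mul_one_div_cancel hq0.ne', Real.rpow_one] at h4
  have hsub : Ioo α β ⊆ interior I := by
    apply interior_maximal _ isOpen_Ioo
    intro x hx
    exact hI.ordConnected.out ha hb ⟨by linarith [hx.1, hα.1], by linarith [hx.2, hβ.2]⟩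
  have hlip : LipschitzOnWith K.toNNReal f (Ioo α β) := by
    apply Convex.lipschitzOnWith_of_nnnorm_hasDerivWithin_le (convex_Ioo α β)
      (f' := f') (fun x hx => (hf x (hsub hx)).hasDerivWithinAt)
    intro x hx
    rw [← NNReal.coe_le_coe, Real.coe_toNNReal _ hK0]
    simpa using hbd x hx
  obtain ⟨g, hg, hfg⟩ := hlip.extend_real
  have hmI : (α + β) / 2 ∈ Ioo α β := ⟨by linarith, by linarith⟩
  have heqfg : ∫ x in α..β, f x = ∫ x in α..β, g x := by
    rw [integral_of_le hφab.le, integral_of_le hφab.le, integral_Ioc_eq_integral_Ioo,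
      integral_Ioc_eq_integral_Ioo]
    exact setIntegral_congr_fun measurableSet_Ioo hfg
  rw [heqfg, hfg hmI]
  set m := (α + β) / 2 with hm
  have hgc : Continuous g := hg.continuous
  have hcen : 1 / (β - α) * (∫ x in α..β, g x) - g m
      = 1 / (β - α) * ∫ x in α..β, (g x - g m) := by
    rw [intervalIntegral.integral_sub (hgc.intervalIntegrable _ _) intervalIntegrable_const]
    simp only [intervalIntegral.integral_const, smul_eq_mul]
    field_simp
  have habs : ∫ x in α..β, |x - m| = (β - α) ^ 2 / 4 := by
    have hc : Continuous fun x : ℝ => |x - m| := by fun_prop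
    rw [← integral_add_adjacent_intervals (hc.intervalIntegrable α m)
      (hc.intervalIntegrable m β)]
    have e1 : ∫ x in α..m, |x - m| = ∫ x in α..m, (m - x) := by
      apply integral_congr
      intro x hx
      rw [uIcc_of_le hmI.1.le] at hx
      simp only
      rw [abs_of_nonpos (by linarith [hx.2])]; ring
    have e2 : ∫ x in m..β, |x - m| = ∫ x in m..β, (x - m) := by
      apply integral_congr
      intro x hx
      rw [uIcc_of_le hmI.2.le] at hx
      simp only
      rw [abs_of_nonneg (by linarith [hx.1])]
    rw [e1, e2, intervalIntegral.integral_sub intervalIntegrable_const ((continuous_id' (X := ℝ)).intervalIntegrable _ _),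
      intervalIntegral.integral_sub ((continuous_id' (X := ℝ)).intervalIntegrable _ _) intervalIntegrable_const]
    simp only [id, intervalIntegral.integral_const, smul_eq_mul, integral_id]
    rw [hm]; ring
  have hbound : |∫ x in α..β, (g x - g m)| ≤ K * ((β - α) ^ 2 / 4) := by
    rw [← habs, ← intervalIntegral.integral_const_mul, ← Real.norm_eq_abs]
    apply intervalIntegral.norm_integral_le_of_norm_le hφab.le
    · refine Filter.Eventually.of_forall fun x _ => ?_
      have := hg.dist_le_mul x m
      rwa [Real.coe_toNNReal _ hK0, Real.dist_eq, Real.dist_eq] at this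
    · exact Continuous.intervalIntegrable (by fun_prop) _ _
  have hleft : |1 / (β - α) * (∫ x in α..β, g x) - g m| ≤ (β - α) * (K / 4) := by
    rw [hcen, abs_mul, abs_of_pos (by positivity : 0 < 1 / (β - α))]
    calc _ ≤ 1 / (β - α) * (K * ((β - α) ^ 2 / 4)) := by gcongr
      _ = _ := by field_simp
  refine hleft.trans ?_
  rw [mul_assoc]
  apply mul_le_mul_of_nonneg_left _ hL.le
  -- constants
  have k1 : 1 / 2 ≤ (1 / (p + 1)) ^ (1 / p) := by
    have hb2 : p + 1 ≤ 2 ^ p := by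
      have := one_add_mul_self_le_rpow_one_add (by norm_num : (-1:ℝ) ≤ 1) hp.le
      norm_num at this
      linarith
    have h1 : ((1:ℝ) / 2) ^ p ≤ 1 / (p + 1) := by
      rw [Real.div_rpow (by norm_num) (by norm_num), Real.one_rpow]
      exact one_div_le_one_div_of_le (by linarith) hb2
    have h2 := Real.rpow_le_rpow (by positivity) h1 (by positivity : 0 ≤ 1 / p)
    rwa [← Real.rpow_mul (by norm_num), mul_one_div_cancel hp0.ne', Real.rpow_one] at h2
  have k2 : K / 2 ≤ (M / 2 + G) ^ (1 / q) := by
    calc K / 2 ≤ K * (1 / 2) ^ (1 / q) := by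
          have : (1 / 2 : ℝ) ^ (1:ℝ) ≤ (1 / 2) ^ (1 / q) :=
            Real.rpow_le_rpow_of_exponent_ge (by norm_num) (by norm_num)
              (by rw [div_le_one hq0]; exact hq.le)
          rw [Real.rpow_one] at this
          rw [div_eq_mul_one_div]
          gcongr
      _ = (M / 2) ^ (1 / q) := by
          rw [hK, ← Real.mul_rpow hM0 (by norm_num)]; congr 1; ring
      _ ≤ _ := Real.rpow_le_rpow (by positivity) (by linarith) (by positivity)
  calc K / 4 = 1 / 2 * (K / 2) := by ring
    _ ≤ _ := by gcongr
end
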